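/- Suppose Conditions 2.1, 4.1 (with parameter θ₁) and 4.3 (with parameters θ₂, θ₃) are met. Then for any c ∈ (0,1), any ω ∈ (0, min{ θ₁/(2(1−θ₁)), θ₂/(2(1−θ₂)), θ₃ − 1/2 }) and any sequence δ_n ↓ 0 with δ_n ≥ c n^{−1}: sup_{u ∈ N(c n^{−1}, δ_n)} | 𝔺_n(u)/g_ω(u) | = o_P(1) as n → ∞. -/

import Mathlib

open MeasureTheory Filter Set
open scoped ENNReal NNReal

noncomputable section

namespace BBV

variable {Ω : Type*} [MeasurableSpace Ω] {E : Type*} [MeasurableSpace E] {d : ℕ}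

/-- The real-valued indicator function of a set. -/
def indic {α : Type*} (s : Set α) (x : α) : ℝ := s.indicator (fun _ => (1 : ℝ)) x

/-- `Z n = o_P(r n)`: convergence to zero in (outer) probability at rate `r`. -/
def oP (P : Measure Ω) (Z : ℕ → Ω → ℝ) (r : ℕ → ℝ) : Prop :=
  ∀ ε : ℝ, 0 < ε → Tendsto (fun n => P {ω | ε * r n < |Z n ω|}) atTop (nhds 0)

/-- `Z n = o_P(1)`: convergence to zero in (outer) probability. -/
def oP1 (P : Measure Ω) (Z : ℕ → Ω → ℝ) : Prop := oP P Z fun _ => 1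

/-- `Z n = O_P(1)`: boundedness in (outer) probability. -/
def bigOP (P : Measure Ω) (Z : ℕ → Ω → ℝ) : Prop :=
  ∀ ε : ℝ, 0 < ε → ∃ M : ℝ, ∀ᶠ n in atTop, P {ω | M < |Z n ω|} ≤ ENNReal.ofReal ε

/-- Strict stationarity of a two-sided sequence: all finite-dimensional distributions
are invariant under shifts. -/
def StrictlyStationary (P : Measure Ω) (X : ℤ → Ω → E) : Prop :=
  ∀ (m : ℕ) (idx : Fin m → ℤ) (k : ℤ),
    Measure.map (fun ω (p : Fin m) => X (idx p + k) ω) P =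
      Measure.map (fun ω (p : Fin m) => X (idx p) ω) P

/-- The sigma-field generated by the variables `X i`, `i ∈ S`. -/
def mixSigma (X : ℤ → Ω → E) (S : Set ℤ) : MeasurableSpace Ω :=
  ⨆ i ∈ S, MeasurableSpace.comap (X i) inferInstance

/-- The alpha-mixing coefficient of the sequence `X`. -/
def alphaMix (P : Measure Ω) (X : ℤ → Ω → E) (k : ℕ) : ℝ :=
  sSup {r : ℝ | ∃ (i : ℤ) (A B : Set Ω),
    MeasurableSet[mixSigma X (Set.Iic i)] A ∧
    MeasurableSet[mixSigma X (Set.Ici (i + (k : ℤ)))] B ∧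
    r = |(P (A ∩ B)).toReal - (P A).toReal * (P B).toReal|}

/-- Exponentially decaying alpha-mixing coefficients: `α(k) = O(a^k)` for some `a ∈ (0,1)`. -/
def ExpAlphaMixing (P : Measure Ω) (X : ℤ → Ω → E) : Prop :=
  ∃ a ∈ Set.Ioo (0 : ℝ) 1, ∃ c : ℝ, ∀ k : ℕ, 1 ≤ k → alphaMix P X k ≤ c * a ^ k

/-- Marginal c.d.f. `F_j` of the stationary sequence. -/
def margF (P : Measure Ω) (X : ℤ → Ω → Fin d → ℝ) (j : Fin d) (x : ℝ) : ℝ :=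
  (P {ω | X 0 ω j ≤ x}).toReal

/-- `U_i = (F_1(X_{i1}),…,F_d(X_{id}))`. -/
def Uv (P : Measure Ω) (X : ℤ → Ω → Fin d → ℝ) (i : ℤ) (ω : Ω) (j : Fin d) : ℝ :=
  margF P X j (X i ω j)

/-- The copula `C` of the stationary distribution, i.e. the c.d.f. of `U_0`. -/
def cop (P : Measure Ω) (X : ℤ → Ω → Fin d → ℝ) (u : Fin d → ℝ) : ℝ :=
  (P {ω | ∀ j, Uv P X 0 ω j ≤ u j}).toReal

/-- Empirical c.d.f. `G_n` of the (unobservable) sample `U_1,…,U_n`. -/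
def Gn (P : Measure Ω) (X : ℤ → Ω → Fin d → ℝ) (n : ℕ) (u : Fin d → ℝ) (ω : Ω) : ℝ :=
  (n : ℝ)⁻¹ * ∑ i ∈ Finset.Icc (1 : ℤ) (n : ℤ), indic {ω' | ∀ j, Uv P X i ω' j ≤ u j} ω

/-- The empirical process `α_n = √n (G_n − C)`. -/
def alphan (P : Measure Ω) (X : ℤ → Ω → Fin d → ℝ) (n : ℕ) (u : Fin d → ℝ) (ω : Ω) : ℝ :=
  Real.sqrt n * (Gn P X n u ω - cop P X u)

/-- Marginal empirical c.d.f. `G_{nj}` based on `U_{1j},…,U_{nj}`. -/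
def Gnj (P : Measure Ω) (X : ℤ → Ω → Fin d → ℝ) (n : ℕ) (j : Fin d) (s : ℝ) (ω : Ω) : ℝ :=
  (n : ℝ)⁻¹ * ∑ i ∈ Finset.Icc (1 : ℤ) (n : ℤ), indic {ω' | Uv P X i ω' j ≤ s} ω

/-- The marginal empirical process `α_{nj}(s) = √n (G_{nj}(s) − s)`. -/
def alphanj (P : Measure Ω) (X : ℤ → Ω → Fin d → ℝ) (n : ℕ) (j : Fin d) (s : ℝ) (ω : Ω) : ℝ :=
  Real.sqrt n * (Gnj P X n j s ω - s)

/-- Left-continuous generalized inverse: `H⁻(s) = inf{x : H(x) ≥ s}` for `s ≠ 0`,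
and `H⁻(0) = sup{x : H(x) = 0}`. -/
def genInv (H : ℝ → ℝ) (s : ℝ) : ℝ :=
  if s = 0 then sSup {x | H x = 0} else sInf {x | s ≤ H x}

/-- The marginal quantile process `β_{nj}(s) = √n (G_{nj}⁻(s) − s)`. -/
def betanj (P : Measure Ω) (X : ℤ → Ω → Fin d → ℝ) (n : ℕ) (j : Fin d) (s : ℝ) (ω : Ω) : ℝ :=
  Real.sqrt n * (genInv (fun x => Gnj P X n j x ω) s - s)

/-- Marginal empirical c.d.f. `F_{nj}` of the observations `X_{1j},…,X_{nj}`. -/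
def empCdfX (X : ℤ → Ω → Fin d → ℝ) (n : ℕ) (j : Fin d) (x : ℝ) (ω : Ω) : ℝ :=
  (n : ℝ)⁻¹ * ∑ i ∈ Finset.Icc (1 : ℤ) (n : ℤ), indic {ω' | X i ω' j ≤ x} ω

/-- Pseudo-observations `Û_{ij} = n/(n+1) · F_{nj}(X_{ij})`. -/
def pseudoObs (X : ℤ → Ω → Fin d → ℝ) (n : ℕ) (i : ℤ) (ω : Ω) (j : Fin d) : ℝ :=
  (n : ℝ) / ((n : ℝ) + 1) * empCdfX X n j (X i ω j) ω

/-- The empirical copula `Ĉ_n`. -/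
def empCop (X : ℤ → Ω → Fin d → ℝ) (n : ℕ) (u : Fin d → ℝ) (ω : Ω) : ℝ :=
  (n : ℝ)⁻¹ * ∑ i ∈ Finset.Icc (1 : ℤ) (n : ℤ), indic {ω' | ∀ j, pseudoObs X n i ω' j ≤ u j} ω

/-- The empirical copula process `ĈP_n = √n (Ĉ_n − C)`. -/
def hatCP (P : Measure Ω) (X : ℤ → Ω → Fin d → ℝ) (n : ℕ) (u : Fin d → ℝ) (ω : Ω) : ℝ :=
  Real.sqrt n * (empCop X n u ω - cop P X u)

/-- First-order partial derivative `Ċ_j` of `C`, defined everywhere as the limsup of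
difference quotients (which coincides with the partial derivative wherever it exists). -/
def Cdot (C : (Fin d → ℝ) → ℝ) (j : Fin d) (u : Fin d → ℝ) : ℝ :=
  Filter.limsup (fun h : ℝ => (C (Function.update u j (u j + h)) - C u) / h)
    (nhdsWithin 0 {(0 : ℝ)}ᶜ)

/-- The process `C̄_n(u) = α_n(u) − Σ_j Ċ_j(u) α_n(u^{(j)})`. -/
def Cbar (P : Measure Ω) (X : ℤ → Ω → Fin d → ℝ) (n : ℕ) (u : Fin d → ℝ) (ω : Ω) : ℝ :=
  alphan P X n u ω -
    ∑ j, Cdot (cop P X) j u * alphan P X n (Function.update (fun _ => (1 : ℝ)) j (u j)) ω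

/-- `C_n(u) = G_n(G_{n1}⁻(u₁),…,G_{nd}⁻(u_d))`. -/
def copGI (P : Measure Ω) (X : ℤ → Ω → Fin d → ℝ) (n : ℕ) (u : Fin d → ℝ) (ω : Ω) : ℝ :=
  Gn P X n (fun j => genInv (fun x => Gnj P X n j x ω) (u j)) ω

/-- The empirical copula process `𝔺_n = √n (C_n − C)` based on generalized inverses. -/
def CPgi (P : Measure Ω) (X : ℤ → Ω → Fin d → ℝ) (n : ℕ) (u : Fin d → ℝ) (ω : Ω) : ℝ :=
  Real.sqrt n * (copGI P X n u ω - cop P X u)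

/-- `g₁(u) = min{ min_j u_j , min_j [1 − min_{k ≠ j} u_k] }`. -/
def g1 (u : Fin d → ℝ) : ℝ :=
  min (⨅ j, u j) (⨅ j : Fin d, (1 - ⨅ k : {k : Fin d // k ≠ j}, u (k : Fin d)))

/-- The weight function `g_ω(u) = g₁(u)^ω`. -/
def gW (w : ℝ) (u : Fin d → ℝ) : ℝ := g1 u ^ w

/-- `g̃_ω(u) = g_ω(u) + 1{g_ω(u) = 0}`. -/
def gTilde (w : ℝ) (u : Fin d → ℝ) : ℝ := if gW w u = 0 then 1 else gW w u

/-- `N(a,b) = {u ∈ [0,1]^d : a < g₁(u) ≤ b}`. -/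
def NN (d : ℕ) (a b : ℝ) : Set (Fin d → ℝ) :=
  {u | (∀ j, 0 ≤ u j ∧ u j ≤ 1) ∧ a < g1 u ∧ g1 u ≤ b}

/-- `V_j = {u ∈ [0,1]^d : u_j ∈ (0,1)}`. -/
def VV (d : ℕ) (j : Fin d) : Set (Fin d → ℝ) :=
  {u | (∀ k, 0 ≤ u k ∧ u k ≤ 1) ∧ 0 < u j ∧ u j < 1}

/-- Condition 2.1: existence, continuity and growth bounds for the first and second
order partial derivatives of the copula `C`. -/
def Condition21 (C : (Fin d → ℝ) → ℝ) : Prop :=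
  (∀ j : Fin d, ∀ u ∈ VV d j,
    HasDerivAt (fun t => C (Function.update u j t)) (Cdot C j u) (u j)) ∧
  (∀ j : Fin d, ContinuousOn (Cdot C j) (VV d j)) ∧
  ∃ Cdd : Fin d → Fin d → (Fin d → ℝ) → ℝ,
    (∀ j₁ j₂ : Fin d, ∀ u ∈ VV d j₁ ∩ VV d j₂,
      HasDerivAt (fun t => Cdot C j₂ (Function.update u j₁ t)) (Cdd j₁ j₂ u) (u j₁)) ∧
    (∀ j₁ j₂ : Fin d, ContinuousOn (Cdd j₁ j₂) (VV d j₁ ∩ VV d j₂)) ∧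
    ∃ K : ℝ, 0 < K ∧ ∀ j₁ j₂ : Fin d, ∀ u ∈ VV d j₁ ∩ VV d j₂,
      |Cdd j₁ j₂ u| ≤ K * min (1 / (u j₁ * (1 - u j₁))) (1 / (u j₂ * (1 - u j₂)))

/-- The weighted modulus of continuity `M_n(δ,μ)` of the empirical process. -/
def Mn (P : Measure Ω) (X : ℤ → Ω → Fin d → ℝ) (n : ℕ) (δ μ : ℝ) (ω : Ω) : ℝ :=
  ⨆ q ∈ {q : (Fin d → ℝ) × (Fin d → ℝ) |
      q.1 ∈ Set.Icc 0 1 ∧ q.2 ∈ Set.Icc 0 1 ∧ dist q.1 q.2 ≤ δ},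
    |alphan P X n q.1 ω - alphan P X n q.2 ω| / max (dist q.1 q.2 ^ μ) ((n : ℝ) ^ (-μ))

/-- Condition 4.1 with parameter `θ₁`. -/
def Condition41 (P : Measure Ω) (X : ℤ → Ω → Fin d → ℝ) (θ₁ : ℝ) : Prop :=
  ∀ μ ∈ Set.Ioo (0 : ℝ) θ₁, ∀ δ : ℕ → ℝ, Tendsto δ atTop (nhds 0) →
    oP1 P (fun n ω => Mn P X n (δ n) μ ω)

/-- Condition 4.3 with parameters `θ₂, θ₃`. -/
def Condition43 (P : Measure Ω) (X : ℤ → Ω → Fin d → ℝ) (θ₂ θ₃ : ℝ) : Prop :=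
  ∀ w ∈ Set.Ioo (0 : ℝ) θ₂, ∀ lam ∈ Set.Ioo (0 : ℝ) θ₃, ∀ j : Fin d,
    bigOP P (fun n ω => ⨆ s ∈ Set.Ioo (0 : ℝ) 1,
      |alphanj P X n j s ω| / (s * (1 - s)) ^ w) ∧
    bigOP P (fun n ω => ⨆ s ∈ Set.Ioo ((n : ℝ) ^ (-lam)) (1 - (n : ℝ) ^ (-lam)),
      |betanj P X n j s ω| / (s * (1 - s)) ^ w)

/-- Telescoping over coordinates: an increment is bounded by the sum of the bounds on the
one-coordinate increments taken at points mixing the coordinates of `u` and `v`. -/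
lemma abs_sub_le_sum_of_coordwise (Φ : (Fin d → ℝ) → ℝ) (u v b : Fin d → ℝ)
    (h : ∀ z : Fin d → ℝ, (∀ i, z i = u i ∨ z i = v i) → ∀ k,
      |Φ (Function.update z k (v k)) - Φ (Function.update z k (u k))| ≤ b k) :
    |Φ v - Φ u| ≤ ∑ k, b k := by
  have key : ∀ S : Finset (Fin d), |Φ (S.piecewise v u) - Φ u| ≤ ∑ k ∈ S, b k := by
    intro S
    induction S using Finset.induction_on with
    | empty => simp
    | insert k S hk ih =>
      rw [Finset.sum_insert hk, Finset.piecewise_insert]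
      have h1 := h (S.piecewise v u) (fun i => by
        by_cases hi : i ∈ S
        · right; simp [hi]
        · left; simp [hi]) k
      have h2 : Function.update (S.piecewise v u) k (u k) = S.piecewise v u := by
        rw [Function.update_eq_self_iff]
        simp [hk]
      rw [h2] at h1
      calc _ ≤ |Φ (Function.update (S.piecewise v u) k (v k)) - Φ (S.piecewise v u)|
            + |Φ (S.piecewise v u) - Φ u| := abs_sub_le _ _ _
        _ ≤ _ := add_le_add h1 ih
  simpa using key Finset.univ

/-- The properties of a copula that are used: coordinatewise monotonicity and Lipschitz
continuity, groundedness and uniform margins. -/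
structure CopulaLike (C : (Fin d → ℝ) → ℝ) : Prop where
  lip : ∀ z ∈ Icc (0 : Fin d → ℝ) 1, ∀ k, ∀ a ∈ Icc (0 : ℝ) 1, ∀ b ∈ Icc (0 : ℝ) 1,
    |C (Function.update z k a) - C (Function.update z k b)| ≤ |a - b|
  mono_coord : ∀ z ∈ Icc (0 : Fin d → ℝ) 1, ∀ k, ∀ a ∈ Icc (0 : ℝ) 1, ∀ b ∈ Icc (0 : ℝ) 1,
    a ≤ b → C (Function.update z k a) ≤ C (Function.update z k b)
  nonneg : ∀ z, 0 ≤ C z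
  grounded : ∀ z : Fin d → ℝ, ∀ j, z j = 0 → C z = 0
  le_coord : ∀ z ∈ Icc (0 : Fin d → ℝ) 1, ∀ j, C z ≤ z j
  margin : ∀ j, ∀ t ∈ Icc (0 : ℝ) 1, C (Function.update 1 j t) = t

lemma update_mem_Icc {z : Fin d → ℝ} (hz : z ∈ Icc (0 : Fin d → ℝ) 1) (k : Fin d) {a : ℝ}
    (ha : a ∈ Icc (0 : ℝ) 1) : Function.update z k a ∈ Icc (0 : Fin d → ℝ) 1 := by
  refine ⟨fun i => ?_, fun i => ?_⟩ <;> by_cases hi : i = k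
  · subst hi; simpa using ha.1
  · simpa [hi] using hz.1 i
  · subst hi; simpa using ha.2
  · simpa [hi] using hz.2 i

lemma coord_mem_Icc {z : Fin d → ℝ} (hz : z ∈ Icc (0 : Fin d → ℝ) 1) (k : Fin d) :
    z k ∈ Icc (0 : ℝ) 1 := ⟨hz.1 k, hz.2 k⟩

lemma mem_VV {z : Fin d → ℝ} (hz : z ∈ Icc (0 : Fin d → ℝ) 1) {k : Fin d}
    (hk : z k ∈ Ioo (0 : ℝ) 1) : z ∈ VV d k :=
  ⟨fun i => coord_mem_Icc hz i, hk.1, hk.2⟩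

lemma CopulaLike.sub_le_sum {C : (Fin d → ℝ) → ℝ} (hC : CopulaLike C) {z : Fin d → ℝ}
    (hz : z ∈ Icc (0 : Fin d → ℝ) 1) (j : Fin d) :
    z j - C z ≤ ∑ k ∈ Finset.univ.erase j, (1 - z k) := by
  have h := abs_sub_le_sum_of_coordwise C z (Function.update 1 j (z j))
    (fun k => if k = j then 0 else 1 - z k) (fun y hy k => by
      have hyc : y ∈ Icc (0 : Fin d → ℝ) 1 := by
        have h1 := update_mem_Icc (z := (1 : Fin d → ℝ)) ⟨zero_le_one, le_rfl⟩ j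
          (coord_mem_Icc hz j)
        refine ⟨fun i => ?_, fun i => ?_⟩ <;> rcases hy i with hi | hi <;> rw [hi]
        exacts [hz.1 i, h1.1 i, hz.2 i, h1.2 i]
      by_cases hk : k = j
      · subst hk; simp
      · simp only [Function.update_of_ne hk, Pi.one_apply, if_neg hk]
        refine (hC.lip y hyc k 1 ⟨zero_le_one, le_rfl⟩ _ (coord_mem_Icc hz k)).trans ?_
        rw [abs_of_nonneg]; linarith [hz.2 k, show (1 : Fin d → ℝ) k = 1 from rfl])
  rw [hC.margin j _ (coord_mem_Icc hz j)] at h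
  refine (le_abs_self _).trans (h.trans (le_of_eq ?_))
  rw [← Finset.add_sum_erase _ _ (Finset.mem_univ j)]
  simp only [if_true, zero_add]
  exact Finset.sum_congr rfl fun k hk => by simp [Finset.ne_of_mem_erase hk]

/-- Increments of the `k`-th first-order partial derivative in another direction `j`. -/
lemma Cdot_increment_le {C : (Fin d → ℝ) → ℝ} {Cdd : Fin d → Fin d → (Fin d → ℝ) → ℝ} {K : ℝ}
    (hcont : ∀ j : Fin d, ContinuousOn (Cdot C j) (VV d j))
    (hder : ∀ j₁ j₂ : Fin d, ∀ u ∈ VV d j₁ ∩ VV d j₂,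
      HasDerivAt (fun t => Cdot C j₂ (Function.update u j₁ t)) (Cdd j₁ j₂ u) (u j₁))
    (hK : 0 < K)
    (hbd : ∀ j₁ j₂ : Fin d, ∀ u ∈ VV d j₁ ∩ VV d j₂,
      |Cdd j₁ j₂ u| ≤ K * min (1 / (u j₁ * (1 - u j₁))) (1 / (u j₂ * (1 - u j₂))))
    {z : Fin d → ℝ} (hz : z ∈ Icc (0 : Fin d → ℝ) 1) {j k : Fin d} (hjk : k ≠ j)
    (hk : z k ∈ Ioo (0 : ℝ) 1) {a b : ℝ} (ha : 0 ≤ a) (hab : a ≤ b) (hb : b ≤ 1) :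
    |Cdot C k (Function.update z j b) - Cdot C k (Function.update z j a)|
      ≤ K * (b - a) / (z k * (1 - z k)) := by
  rcases hab.eq_or_lt with rfl | hlt
  · simp
  have hV : ∀ t ∈ Icc a b, Function.update z j t ∈ VV d k := fun t ht =>
    mem_VV (update_mem_Icc hz j ⟨ha.trans ht.1, ht.2.trans hb⟩)
      (by rw [Function.update_of_ne hjk]; exact hk)
  have hVj : ∀ t ∈ Ioo a b, Function.update z j t ∈ VV d j := fun t ht =>
    mem_VV (update_mem_Icc hz j ⟨ha.trans ht.1.le, ht.2.le.trans hb⟩)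
      (by simpa using ⟨ha.trans_lt ht.1, ht.2.trans_le hb⟩)
  obtain ⟨t, ht, hslope⟩ := exists_hasDerivAt_eq_slope
    (fun t => Cdot C k (Function.update z j t)) (fun t => Cdd j k (Function.update z j t)) hlt
    ((hcont k).comp (by fun_prop) fun t ht => hV t ht)
    (fun t ht => by
      have := hder j k _ ⟨hVj t ht, hV t (Ioo_subset_Icc_self ht)⟩
      simpa using this)
  have h1 := hbd j k _ ⟨hVj t ht, hV t (Ioo_subset_Icc_self ht)⟩
  have hp : 0 < z k * (1 - z k) := mul_pos hk.1 (by linarith [hk.2])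
  have h2 : |Cdd j k (Function.update z j t)| ≤ K * (1 / (z k * (1 - z k))) := by
    refine h1.trans (mul_le_mul_of_nonneg_left ?_ hK.le)
    rw [Function.update_of_ne hjk]
    exact min_le_right _ _
  have hba : 0 < b - a := sub_pos.2 hlt
  rw [hslope, abs_div, abs_of_pos hba, div_le_iff₀ hba] at h2
  refine h2.trans (le_of_eq ?_)
  ring

/-- First-order partial derivatives of a copula vanish linearly near the lower faces. -/
lemma abs_Cdot_le_of_condition21 {C : (Fin d → ℝ) → ℝ} (hC : CopulaLike C)
    (h : Condition21 C) : ∃ K : ℝ, 0 < K ∧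
      (∀ z ∈ Icc (0 : Fin d → ℝ) 1, ∀ j k, k ≠ j → z k ∈ Ioo (0 : ℝ) 1 →
        |Cdot C k z| ≤ K * z j / (z k * (1 - z k))) ∧
      (∀ z ∈ Icc (0 : Fin d → ℝ) 1, ∀ j, z j ∈ Ioo (0 : ℝ) 1 →
        |1 - Cdot C j z| ≤ K * (∑ k ∈ Finset.univ.erase j, (1 - z k)) / (z j * (1 - z j))) := by
  obtain ⟨hd1, hcont, Cdd, hder, -, K, hK, hbd⟩ := h
  refine ⟨K, hK, fun z hz j k hjk hk => ?_, fun z hz j hj => ?_⟩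
  · have h1 := Cdot_increment_le hcont hder hK hbd hz hjk hk le_rfl (hz.1 j) (hz.2 j)
    have h0 : Cdot C k (Function.update z j 0) = 0 := by
      have h2 := hd1 k (Function.update z j 0)
        (mem_VV (update_mem_Icc hz j ⟨le_rfl, zero_le_one⟩)
          (by rw [Function.update_of_ne hjk]; exact hk))
      refine h2.unique ?_
      have : (fun t => C (Function.update (Function.update z j 0) k t)) = fun _ => 0 := by
        funext t
        exact hC.grounded _ j (by rw [Function.update_of_ne hjk.symm]; simp)
      rw [this]
      exact hasDerivAt_const _ _
    simpa [h0] using h1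
  · have hz1 := update_mem_Icc (z := (1 : Fin d → ℝ)) ⟨zero_le_one, le_rfl⟩ j
      (coord_mem_Icc hz j)
    have h1 : Cdot C j (Function.update 1 j (z j)) = 1 := by
      have h2 := hd1 j (Function.update 1 j (z j)) (mem_VV hz1 (by simpa using hj))
      refine h2.unique ?_
      simp only [Function.update_idem, Function.update_self]
      refine (hasDerivAt_id (z j)).congr_of_eventuallyEq ?_
      filter_upwards [Ioo_mem_nhds hj.1 hj.2] with t ht
      exact hC.margin j t (Ioo_subset_Icc_self ht)
    have h := abs_sub_le_sum_of_coordwise (Cdot C j) z (Function.update 1 j (z j))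
      (fun k => if k = j then 0 else K * (1 - z k) / (z j * (1 - z j))) (fun y hy k => by
        have hyc : y ∈ Icc (0 : Fin d → ℝ) 1 := by
          refine ⟨fun i => ?_, fun i => ?_⟩ <;> rcases hy i with hi | hi <;> rw [hi]
          exacts [hz.1 i, hz1.1 i, hz.2 i, hz1.2 i]
        have hyj : y j = z j := by rcases hy j with hi | hi <;> simp [hi]
        by_cases hk : k = j
        · subst hk; simp
        · simp only [Function.update_of_ne hk, Pi.one_apply, if_neg hk]
          have := Cdot_increment_le hcont hder hK hbd hyc (Ne.symm hk) (hyj ▸ hj)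
            (hz.1 k) (hz.2 k) le_rfl
          rwa [hyj] at this)
    rw [h1] at h
    refine h.trans (le_of_eq ?_)
    rw [← Finset.add_sum_erase _ _ (Finset.mem_univ j)]
    simp only [if_true, zero_add]
    rw [Finset.mul_sum, Finset.sum_div]
    exact Finset.sum_congr rfl fun k hk => by simp [Finset.ne_of_mem_erase hk]

/-- Increment bound for a Lipschitz function whose derivative explodes at most like
`1 / (s (1 - s))` at the end points. -/
lemma abs_increment_le_rpow {f f' : ℝ → ℝ} {L b p u v : ℝ} (hL : 0 ≤ L)
    (hp : p ∈ Ioo (0 : ℝ) 1)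
    (hlip : ∀ a ∈ Icc (0 : ℝ) 1, ∀ b ∈ Icc (0 : ℝ) 1, |f a - f b| ≤ |a - b|)
    (hder : ∀ s ∈ Ioo (0 : ℝ) 1, HasDerivAt f (f' s) s)
    (hbd : ∀ s ∈ Ioo (0 : ℝ) 1, |f' s| ≤ L / (s * (1 - s)))
    (hu : u ∈ Ioo (0 : ℝ) 1) (huv : |v - u| ≤ min u (1 - u) / 2)
    (hb : |v - u| ≤ b * (u * (1 - u)) ^ p) :
    |f v - f u| ≤ b * (4 * L) ^ p := by
  have hx : 0 < u * (1 - u) := mul_pos hu.1 (by linarith [hu.2])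
  have hb0 : 0 ≤ b := by
    have := (abs_nonneg _).trans hb
    exact nonneg_of_mul_nonneg_left this (Real.rpow_pos_of_pos hx p)
  have h1 : min u (1 - u) ≤ u := min_le_left _ _
  have h2 : min u (1 - u) ≤ 1 - u := min_le_right _ _
  have h3 := abs_le.1 huv
  have hu0 := hu.1
  have hu1 := hu.2
  have hv : v ∈ Icc (u / 2) (1 - (1 - u) / 2) := ⟨by linarith, by linarith⟩
  have hl : |f v - f u| ≤ |v - u| :=
    hlip v ⟨by linarith [hv.1], by linarith [hv.2]⟩ u ⟨hu0.le, hu1.le⟩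
  have hsub : Icc (u / 2) (1 - (1 - u) / 2) ⊆ Ioo (0 : ℝ) 1 := fun s hs =>
    ⟨by linarith [hs.1], by linarith [hs.2]⟩
  have hm : |f v - f u| ≤ 4 * L / (u * (1 - u)) * |v - u| := by
    have := Convex.norm_image_sub_le_of_norm_hasDerivWithin_le (f := f) (f' := f')
      (s := Icc (u / 2) (1 - (1 - u) / 2)) (C := 4 * L / (u * (1 - u)))
      (fun s hs => (hder s (hsub hs)).hasDerivWithinAt)
      (fun s hs => by
        refine (hbd s (hsub hs)).trans ?_
        have hs0 := hs.1
        have hs1 := hs.2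
        rw [div_le_div_iff₀ (mul_pos (by linarith) (by linarith)) hx]
        have : u * (1 - u) ≤ 4 * (s * (1 - s)) := by
          have := mul_le_mul hs0 (show (1 - u) / 2 ≤ 1 - s by linarith) (by linarith)
            (by linarith)
          linarith
        nlinarith)
      (convex_Icc _ _) (x := u) (y := v) ⟨by linarith, by linarith⟩ hv
    simpa [Real.norm_eq_abs] using this
  set y := 4 * L / (u * (1 - u)) with hy
  have hy0 : 0 ≤ y := by positivity
  have hyp : |f v - f u| ≤ y ^ p * |v - u| := by
    rcases le_total y 1 with h | h
    · refine hm.trans (mul_le_mul_of_nonneg_right ?_ (abs_nonneg _))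
      exact Real.self_le_rpow_of_le_one hy0 h hp.2.le
    · refine hl.trans (le_mul_of_one_le_left (abs_nonneg _) ?_)
      exact Real.one_le_rpow h hp.1.le
  refine hyp.trans ((mul_le_mul_of_nonneg_left hb (by positivity)).trans (le_of_eq ?_))
  rw [hy, Real.div_rpow (by positivity) hx.le]
  have : (u * (1 - u)) ^ p ≠ 0 := (Real.rpow_pos_of_pos hx p).ne'
  field_simp

/-- Deterministic properties of a quantile function `Q` that stays close to the identity at
scale `r⁻¹` away from the end points. -/
structure QuantileBounds (Q : ℝ → ℝ) (r B p ν : ℝ) : Prop where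
  mem : ∀ s ∈ Ioc (0 : ℝ) 1, Q s ∈ Icc (0 : ℝ) 1
  mono : ∀ s ∈ Ioc (0 : ℝ) 1, ∀ t ∈ Ioc (0 : ℝ) 1, s ≤ t → Q s ≤ Q t
  beta : ∀ s ∈ Ioo ν (1 - ν), r * |Q s - s| ≤ B * (s * (1 - s)) ^ p
  r_pos : 0 < r
  B_nonneg : 0 ≤ B
  p_mem : p ∈ Ioo (0 : ℝ) 1
  ν_pos : 0 < ν
  ν_le : ν ≤ 1 / 8
  scale : B / r * ν ^ (p - 1) ≤ 1 / 2

namespace QuantileBounds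

variable {Q : ℝ → ℝ} {r B p ν : ℝ}

lemma abs_sub_le (h : QuantileBounds Q r B p ν) {s : ℝ} (hs : s ∈ Ioo ν (1 - ν)) :
    |Q s - s| ≤ B / r * (s * (1 - s)) ^ p := by
  have := h.beta s hs
  rw [div_mul_eq_mul_div, le_div_iff₀ h.r_pos]
  linarith

lemma abs_sub_le_min (h : QuantileBounds Q r B p ν) {s : ℝ} (hs : s ∈ Ioo ν (1 - ν)) :
    |Q s - s| ≤ min s (1 - s) / 2 := by
  have hν := h.ν_pos
  have h0 : 0 < s := hν.trans hs.1
  have h1 : s < 1 := by linarith [hs.2]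
  set t := min s (1 - s) with ht
  have htν : ν < t := lt_min hs.1 (by linarith [hs.2])
  have ht0 : 0 < t := hν.trans htν
  have hst : s * (1 - s) ≤ t := le_min (by nlinarith) (by nlinarith)
  have hBr : 0 ≤ B / r := div_nonneg h.B_nonneg h.r_pos.le
  calc |Q s - s| ≤ B / r * (s * (1 - s)) ^ p := h.abs_sub_le hs
    _ ≤ B / r * t ^ p := by
        refine mul_le_mul_of_nonneg_left ?_ hBr
        exact Real.rpow_le_rpow (mul_nonneg h0.le (by linarith)) hst h.p_mem.1.le
    _ = B / r * t ^ (p - 1) * t := by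
        rw [mul_assoc, ← Real.rpow_add_one ht0.ne']; ring_nf
    _ ≤ B / r * ν ^ (p - 1) * t := by
        refine mul_le_mul_of_nonneg_right (mul_le_mul_of_nonneg_left ?_ hBr) ht0.le
        exact Real.rpow_le_rpow_of_nonpos hν htν.le (by linarith [h.p_mem.2])
    _ ≤ 1 / 2 * t := mul_le_mul_of_nonneg_right h.scale ht0.le
    _ = t / 2 := by ring

lemma abs_sub_le_of_notMem (h : QuantileBounds Q r B p ν) {s : ℝ} (hs : s ∈ Ioc (0 : ℝ) 1)
    (hs' : s ∉ Ioo ν (1 - ν)) : |Q s - s| ≤ 3 * ν := by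
  have hν := h.ν_pos
  have hν' := h.ν_le
  have hm := h.mem s hs
  have ha : 2 * ν ∈ Ioo ν (1 - ν) := ⟨by linarith, by linarith⟩
  have hb : 1 - 2 * ν ∈ Ioo ν (1 - ν) := ⟨by linarith, by linarith⟩
  have ha' := abs_le.1 ((h.abs_sub_le_min ha).trans
    (div_le_div_of_nonneg_right (min_le_left _ _) zero_le_two))
  have hb' := abs_le.1 ((h.abs_sub_le_min hb).trans
    (div_le_div_of_nonneg_right (min_le_right _ _) zero_le_two))
  rcases le_or_gt s ν with h1 | h1
  · have := h.mono s hs (2 * ν) ⟨by linarith, by linarith⟩ (by linarith)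
    rw [abs_le]
    constructor <;> linarith [hm.1, hs.1]
  · have h2 : 1 - ν ≤ s := not_lt.1 fun h2 => hs' ⟨h1, h2⟩
    have := h.mono (1 - 2 * ν) ⟨by linarith, by linarith⟩ s hs (by linarith)
    rw [abs_le]
    constructor <;> linarith [hm.2, hs.2]

/-- Below `2 g` at level `g`. -/
lemma le_two_mul (h : QuantileBounds Q r B p ν) {g : ℝ} (hg : ν < g) (hg' : g < 1 / 2) :
    Q g ≤ 2 * g := by
  have := abs_le.1 ((h.abs_sub_le_min (s := g) ⟨hg, by linarith [h.ν_le]⟩).trans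
    (div_le_div_of_nonneg_right (min_le_left _ _) zero_le_two))
  linarith [h.ν_pos]

/-- Above `1 - 2 g` beyond level `1 - g`. -/
lemma one_sub_le_two_mul (h : QuantileBounds Q r B p ν) {g s : ℝ} (hg : ν < g) (hg' : g < 1 / 2)
    (hs : 1 - g ≤ s) (hs1 : s ≤ 1) : 1 - Q s ≤ 2 * g := by
  have := abs_le.1 ((h.abs_sub_le_min (s := 1 - g) ⟨by linarith [h.ν_le], by linarith⟩).trans
    (div_le_div_of_nonneg_right (min_le_right _ _) zero_le_two))
  have h2 := h.mono (1 - g) ⟨by linarith, by linarith [h.ν_pos]⟩ s ⟨by linarith, hs1⟩ hs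
  linarith [h.ν_pos]

/-- The weighted bound at the scales where the quantile process is not controlled. -/
lemma mul_le_of_notMem (h : QuantileBounds Q r B p ν) {s g w e : ℝ} (hs : s ∈ Ioc (0 : ℝ) 1)
    (hs' : s ∉ Ioo ν (1 - ν)) (hg : ν < g) (hw : 0 ≤ w) (he : r * ν ^ (1 - w) ≤ e) :
    r * |Q s - s| ≤ 3 * e * g ^ w := by
  have hν := h.ν_pos
  calc r * |Q s - s| ≤ r * (3 * ν) :=
        mul_le_mul_of_nonneg_left (h.abs_sub_le_of_notMem hs hs') h.r_pos.le
    _ = 3 * (r * ν ^ (1 - w)) * ν ^ w := by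
        have : ν = ν ^ (1 - w) * ν ^ w := by
          rw [← Real.rpow_add hν]; simp
        nth_rewrite 1 [this]; ring
    _ ≤ 3 * e * g ^ w := by
        have h0 : 0 ≤ r * ν ^ (1 - w) := by have := h.r_pos; positivity
        exact mul_le_mul (by linarith) (Real.rpow_le_rpow hν.le hg.le hw) (by positivity)
          (by linarith)

lemma rpow_scale {B p w g δ e M : ℝ} (hB : 0 ≤ B) (hM : 0 ≤ M) (hg0 : 0 < g)
    (hgδ : g ≤ δ) (hwp : w ≤ p) (he : B * M ^ p * δ ^ (p - w) ≤ e) :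
    B * (M * g) ^ p ≤ e * g ^ w := by
  have h1 : g ^ p = g ^ (p - w) * g ^ w := by rw [← Real.rpow_add hg0]; simp
  rw [Real.mul_rpow hM hg0.le, h1]
  calc B * (M ^ p * (g ^ (p - w) * g ^ w)) = B * M ^ p * g ^ (p - w) * g ^ w := by ring
    _ ≤ B * M ^ p * δ ^ (p - w) * g ^ w := by
        have := Real.rpow_le_rpow hg0.le hgδ (by linarith : 0 ≤ p - w)
        gcongr
    _ ≤ _ := by gcongr

/-- Quantile increments in coordinates close to the boundary. -/
lemma mul_abs_sub_le (h : QuantileBounds Q r B p ν) {s g w e δ : ℝ} (hs : s ∈ Ioc (0 : ℝ) 1)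
    (hsg : s ≤ g ∨ 1 - s ≤ g) (hg : ν < g) (hgδ : g ≤ δ) (hw : 0 ≤ w) (hwp : w ≤ p)
    (he : r * ν ^ (1 - w) ≤ e) (he' : B * δ ^ (p - w) ≤ e) :
    r * |Q s - s| ≤ 3 * e * g ^ w := by
  by_cases hs' : s ∈ Ioo ν (1 - ν)
  · have hg0 : 0 < g := h.ν_pos.trans hg
    have h1 := rpow_scale (M := 1) h.B_nonneg zero_le_one hg0 hgδ hwp (e := e) (by simpa using he')
    rw [one_mul] at h1
    have h0 : 0 ≤ e := le_trans (by have := h.r_pos; have := h.ν_pos; positivity) he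
    have h3 : s * (1 - s) ≤ g := by
      have h4 := hs.1
      have h5 := hs.2
      rcases hsg with h6 | h6 <;> nlinarith
    calc r * |Q s - s| ≤ B * (s * (1 - s)) ^ p := h.beta s hs'
      _ ≤ B * g ^ p := mul_le_mul_of_nonneg_left
          (Real.rpow_le_rpow (mul_nonneg hs.1.le (by linarith [hs.2])) h3 h.p_mem.1.le) h.B_nonneg
      _ ≤ e * g ^ w := h1
      _ ≤ 3 * e * g ^ w := by
          have : 0 ≤ e * g ^ w := by positivity
          linarith
  · exact h.mul_le_of_notMem hs hs' hg hw he

/-- Quantile increments of a Lipschitz function whose derivative is of order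
`g / (s (1 - s))`. -/
lemma mul_abs_increment_le (h : QuantileBounds Q r B p ν) {f f' : ℝ → ℝ} {s g w e δ L : ℝ}
    (hs : s ∈ Ioc (0 : ℝ) 1) (hL : 0 ≤ L)
    (hlip : ∀ a ∈ Icc (0 : ℝ) 1, ∀ b ∈ Icc (0 : ℝ) 1, |f a - f b| ≤ |a - b|)
    (hder : ∀ s ∈ Ioo (0 : ℝ) 1, HasDerivAt f (f' s) s)
    (hbd : ∀ s ∈ Ioo (0 : ℝ) 1, |f' s| ≤ L * g / (s * (1 - s)))
    (hg : ν < g) (hgδ : g ≤ δ) (hw : 0 ≤ w) (hwp : w ≤ p)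
    (he : r * ν ^ (1 - w) ≤ e) (he' : B * (4 * L) ^ p * δ ^ (p - w) ≤ e) :
    r * |f (Q s) - f s| ≤ 3 * e * g ^ w := by
  have hr := h.r_pos
  have hν := h.ν_pos
  have hg0 : 0 < g := hν.trans hg
  by_cases hs' : s ∈ Ioo ν (1 - ν)
  · have h1 := rpow_scale h.B_nonneg (by positivity : 0 ≤ 4 * L) hg0 hgδ hwp he'
    have h0 : 0 ≤ e := le_trans (by positivity) he
    have h2 := abs_increment_le_rpow (L := L * g) (by positivity) h.p_mem hlip hder hbd
      (u := s) (v := Q s) ⟨hs.1, by linarith [hs'.2]⟩ (h.abs_sub_le_min hs') (h.abs_sub_le hs')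
    calc r * |f (Q s) - f s| ≤ r * (B / r * (4 * (L * g)) ^ p) :=
          mul_le_mul_of_nonneg_left h2 hr.le
      _ = B * (4 * L * g) ^ p := by
          rw [← mul_assoc, mul_div_cancel₀ _ hr.ne', mul_assoc 4]
      _ ≤ e * g ^ w := h1
      _ ≤ 3 * e * g ^ w := by
          have : 0 ≤ e * g ^ w := by positivity
          linarith
  · refine le_trans ?_ (h.mul_le_of_notMem hs hs' hg hw he)
    exact mul_le_mul_of_nonneg_left (hlip _ (h.mem s hs) _ ⟨hs.1.le, hs.2⟩) hr.le

end QuantileBounds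

/-- Deterministic properties of a realization of an empirical distribution function `G` with
marginals `H` and marginal quantile functions `Q`. -/
structure RegularPath (n : ℕ) (C G : (Fin d → ℝ) → ℝ) (H Q : Fin d → ℝ → ℝ)
    (B p ν μ η δ' : ℝ) : Prop where
  quantile : ∀ k, QuantileBounds (Q k) (Real.sqrt n) B p ν
  le_H : ∀ k, ∀ s ∈ Ioc (0 : ℝ) 1, s ≤ H k (Q k s)
  H_lt : ∀ k, ∀ s ∈ Ioc (0 : ℝ) 1, ∀ x, x < Q k s → H k x < s
  H_zero : ∀ k, H k 0 = 0
  nonneg : ∀ z, 0 ≤ G z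
  le_margin : ∀ z j, G z ≤ H j (z j)
  sub_le_sum : ∀ z j, H j (z j) - G z ≤ ∑ k ∈ Finset.univ.erase j, (1 - H k (z k))
  margin : ∀ j, ∀ t, G (Function.update 1 j t) = H j t
  modulus : ∀ z ∈ Icc (0 : Fin d → ℝ) 1, ∀ y ∈ Icc (0 : Fin d → ℝ) 1, dist z y ≤ δ' →
    |Real.sqrt n * (G z - C z) - Real.sqrt n * (G y - C y)|
      ≤ η * max (dist z y ^ μ) ((n : ℝ) ^ (-μ))

lemma dist_update_le (z : Fin d → ℝ) (j : Fin d) (a : ℝ) :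
    dist z (Function.update z j a) ≤ |z j - a| := by
  refine (dist_pi_le_iff (abs_nonneg _)).2 fun i => ?_
  by_cases hi : i = j
  · subst hi; simp [Real.dist_eq]
  · simp [hi]

namespace RegularPath

variable {n : ℕ} {C G : (Fin d → ℝ) → ℝ} {H Q : Fin d → ℝ → ℝ} {δ' B p ν μ η : ℝ}

/-- The jumps of the marginal empirical distribution functions are small. -/
lemma H_quantile_le (h : RegularPath n C G H Q B p ν μ η δ') (hC : CopulaLike C) (hn : 1 ≤ n)
    (hη : 0 ≤ η) (hμ : 0 ≤ μ) (hδ' : 1 / (n : ℝ) ≤ δ') (k : Fin d) {s : ℝ}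
    (hs : s ∈ Ioc (0 : ℝ) 1) :
    Real.sqrt n * (H k (Q k s) - s) ≤ Real.sqrt n / n + η * (n : ℝ) ^ (-μ) := by
  have hn0 : (0 : ℝ) < n := by exact_mod_cast hn
  have hq := (h.quantile k).mem s hs
  have hr := (h.quantile k).r_pos
  set y := max (Q k s - 1 / n) 0 with hy
  have hy1 : y ≤ Q k s := max_le (by linarith [one_div_pos.2 hn0]) hq.1
  have hy0 : 0 ≤ y := le_max_right _ _
  have hyd : Q k s - y ≤ 1 / n := by linarith [le_max_left (Q k s - 1 / n) 0]
  have hHy : H k y ≤ s := by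
    rcases hy1.lt_or_eq with h1 | h1
    · exact (h.H_lt k s hs y h1).le
    · rcases le_total (Q k s - 1 / n) 0 with h2 | h2
      · rw [hy, max_eq_right h2, h.H_zero]; exact hs.1.le
      · exfalso
        rw [hy, max_eq_left h2] at h1
        linarith [one_div_pos.2 hn0]
  have hone : (1 : Fin d → ℝ) ∈ Icc (0 : Fin d → ℝ) 1 := ⟨zero_le_one, le_rfl⟩
  have hymem : y ∈ Icc (0 : ℝ) 1 := ⟨hy0, hy1.trans hq.2⟩
  have hd : dist (Function.update (1 : Fin d → ℝ) k (Q k s)) (Function.update 1 k y) ≤ 1 / n := by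
    have := dist_update_le (Function.update (1 : Fin d → ℝ) k (Q k s)) k y
    rw [Function.update_idem, Function.update_self, abs_of_nonneg (sub_nonneg.2 hy1)] at this
    exact this.trans hyd
  have hm := h.modulus _ (update_mem_Icc hone k hq) _ (update_mem_Icc hone k hymem)
    (hd.trans hδ')
  rw [h.margin, h.margin, hC.margin _ _ hq, hC.margin _ _ hymem] at hm
  have hmax : max (dist (Function.update (1 : Fin d → ℝ) k (Q k s)) (Function.update 1 k y) ^ μ)
      ((n : ℝ) ^ (-μ)) ≤ (n : ℝ) ^ (-μ) := by
    refine max_le ?_ le_rfl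
    refine (Real.rpow_le_rpow dist_nonneg hd hμ).trans (le_of_eq ?_)
    rw [one_div, Real.inv_rpow hn0.le, Real.rpow_neg hn0.le]
  have hm' := (le_abs_self _).trans (hm.trans (mul_le_mul_of_nonneg_left hmax hη))
  have h3 := mul_le_mul_of_nonneg_left hHy hr.le
  have h4 := mul_le_mul_of_nonneg_left hyd hr.le
  have h5 : Real.sqrt n / n = Real.sqrt n * (1 / n) := by ring
  rw [h5]
  linarith

end RegularPath

/-- The smallness requirements on the parameters of a `RegularPath`. -/
structure ScaleBounds (n : ℕ) (c w p ν μ η B L δ e : ℝ) : Prop where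
  n_pos : 1 ≤ n
  c_mem : c ∈ Ioo (0 : ℝ) 1
  w_pos : 0 < w
  w_lt_p : w < p
  w_lt_μ : w < μ
  μ_le : μ ≤ 1
  η_nonneg : 0 ≤ η
  one_le_L : 1 ≤ L
  δ_lt : δ < 1 / 2
  small : Real.sqrt n * ν ^ (1 - w) ≤ e
  modulus : η / c ≤ e
  discrete : (n : ℝ) ^ (w - 1 / 2) / c ≤ e
  beta : B * (4 * L) ^ p * δ ^ (p - w) ≤ e

namespace ScaleBounds

variable {n : ℕ} {c w p ν μ η B L δ e g : ℝ}

lemma e_nonneg (h : ScaleBounds n c w p ν μ η B L δ e) : 0 ≤ e :=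
  (div_nonneg h.η_nonneg h.c_mem.1.le).trans h.modulus

lemma rpow_neg_le (h : ScaleBounds n c w p ν μ η B L δ e) (hg : c / n < g) :
    (n : ℝ) ^ (-w) ≤ g ^ w / c := by
  have hn0 : (0 : ℝ) < n := by exact_mod_cast h.n_pos
  have hn1 : (1 : ℝ) ≤ n := by exact_mod_cast h.n_pos
  have hc := h.c_mem
  have h1 : (c / n) ^ w ≤ g ^ w :=
    Real.rpow_le_rpow (by have := hc.1; positivity) hg.le h.w_pos.le
  rw [Real.div_rpow hc.1.le hn0.le] at h1
  have h2 : c ≤ c ^ w := Real.self_le_rpow_of_le_one hc.1.le hc.2.le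
    (h.w_lt_μ.le.trans h.μ_le)
  rw [le_div_iff₀ hc.1]
  calc (n : ℝ) ^ (-w) * c ≤ (n : ℝ) ^ (-w) * c ^ w := by gcongr
    _ = c ^ w / (n : ℝ) ^ w := by rw [Real.rpow_neg hn0.le]; field_simp
    _ ≤ g ^ w := h1

lemma η_mul_le (h : ScaleBounds n c w p ν μ η B L δ e) (hg : c / n < g) :
    η * (n : ℝ) ^ (-μ) ≤ e * g ^ w := by
  have hn1 : (1 : ℝ) ≤ n := by exact_mod_cast h.n_pos
  have hn0 : (0 : ℝ) < n := by linarith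
  have hg0 : 0 < g := lt_of_le_of_lt (div_nonneg h.c_mem.1.le hn0.le) hg
  have h1 : (n : ℝ) ^ (-μ) ≤ (n : ℝ) ^ (-w) :=
    Real.rpow_le_rpow_of_exponent_le hn1 (by linarith [h.w_lt_μ])
  calc η * (n : ℝ) ^ (-μ) ≤ η * (g ^ w / c) :=
        mul_le_mul_of_nonneg_left (h1.trans (h.rpow_neg_le hg)) h.η_nonneg
    _ = η / c * g ^ w := by ring
    _ ≤ e * g ^ w := mul_le_mul_of_nonneg_right h.modulus (by positivity)

lemma modulus_le (h : ScaleBounds n c w p ν μ η B L δ e) (hg : c / n < g) (hgδ : g ≤ δ)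
    {t : ℝ} (ht0 : 0 ≤ t) (ht : t ≤ 2 * g) :
    η * max (t ^ μ) ((n : ℝ) ^ (-μ)) ≤ 2 * e * g ^ w := by
  have hn1 : (1 : ℝ) ≤ n := by exact_mod_cast h.n_pos
  have hn0 : (0 : ℝ) < n := by linarith
  have hc := h.c_mem
  have hg0 : 0 < g := lt_of_le_of_lt (div_nonneg h.c_mem.1.le hn0.le) hg
  have hμ : 0 ≤ μ := h.w_pos.le.trans h.w_lt_μ.le
  have h0 : 0 ≤ e * g ^ w := mul_nonneg h.e_nonneg (by positivity)
  rw [mul_max_of_nonneg _ _ h.η_nonneg]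
  refine max_le ?_ (by linarith [h.η_mul_le hg])
  have h1 : t ^ μ ≤ 2 * g ^ w := by
    calc t ^ μ ≤ (2 * g) ^ μ := Real.rpow_le_rpow ht0 ht hμ
      _ = 2 ^ μ * g ^ μ := Real.mul_rpow zero_le_two hg0.le
      _ ≤ 2 ^ (1 : ℝ) * g ^ w := by
          refine mul_le_mul (Real.rpow_le_rpow_of_exponent_le one_le_two h.μ_le) ?_
            (by positivity) (by positivity)
          exact Real.rpow_le_rpow_of_exponent_ge hg0 (by linarith [h.δ_lt]) h.w_lt_μ.le
      _ = 2 * g ^ w := by rw [Real.rpow_one]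
  have h2 : η ≤ e := by
    refine le_trans ?_ h.modulus
    exact le_div_self h.η_nonneg hc.1 hc.2.le
  calc η * t ^ μ ≤ e * (2 * g ^ w) := mul_le_mul h2 h1 (by positivity) h.e_nonneg
    _ = 2 * e * g ^ w := by ring

lemma sqrt_div_le (h : ScaleBounds n c w p ν μ η B L δ e) (hg : c / n < g) :
    Real.sqrt n / n ≤ e * g ^ w := by
  have hn1 : (1 : ℝ) ≤ n := by exact_mod_cast h.n_pos
  have hn0 : (0 : ℝ) < n := by linarith
  have hc := h.c_mem
  have hg0 : 0 < g := lt_of_le_of_lt (div_nonneg h.c_mem.1.le hn0.le) hg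
  have h1 : Real.sqrt n / n = (n : ℝ) ^ (w - 1 / 2) * (n : ℝ) ^ (-w) := by
    rw [← Real.rpow_add hn0, Real.sqrt_eq_rpow]
    nth_rewrite 2 [← Real.rpow_one (n : ℝ)]
    rw [← Real.rpow_sub hn0]
    congr 1; ring
  rw [h1]
  calc (n : ℝ) ^ (w - 1 / 2) * (n : ℝ) ^ (-w) ≤ (n : ℝ) ^ (w - 1 / 2) * (g ^ w / c) :=
        mul_le_mul_of_nonneg_left (h.rpow_neg_le hg) (by positivity)
    _ = (n : ℝ) ^ (w - 1 / 2) / c * g ^ w := by ring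
    _ ≤ _ := mul_le_mul_of_nonneg_right h.discrete (by positivity)

lemma sqrt_mul_le (h : ScaleBounds n c w p ν μ η B L δ e) (hw : w ≤ 1) (hg0 : 0 < g)
    (hg : g ≤ ν) : Real.sqrt n * g ≤ e * g ^ w := by
  have h1 : g = g ^ (1 - w) * g ^ w := by rw [← Real.rpow_add hg0]; simp
  calc Real.sqrt n * g = Real.sqrt n * g ^ (1 - w) * g ^ w := by
        nth_rewrite 1 [h1]; ring
    _ ≤ Real.sqrt n * ν ^ (1 - w) * g ^ w := by
        have := Real.rpow_le_rpow hg0.le hg (by linarith : 0 ≤ 1 - w)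
        gcongr
    _ ≤ _ := mul_le_mul_of_nonneg_right h.small (by positivity)

lemma beta' (h : ScaleBounds n c w p ν μ η B L δ e) (hB : 0 ≤ B) (hδ : 0 ≤ δ) :
    B * δ ^ (p - w) ≤ e := by
  refine le_trans ?_ h.beta
  have h1 : 1 ≤ (4 * L) ^ p :=
    Real.one_le_rpow (by linarith [h.one_le_L]) (h.w_pos.trans h.w_lt_p).le
  have := Real.rpow_nonneg hδ (p - w)
  nlinarith [mul_nonneg hB this]

end ScaleBounds

lemma mix_mem_Icc {u v z : Fin d → ℝ} (hu : u ∈ Icc (0 : Fin d → ℝ) 1)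
    (hv : v ∈ Icc (0 : Fin d → ℝ) 1) (hz : ∀ i, z i = u i ∨ z i = v i) :
    z ∈ Icc (0 : Fin d → ℝ) 1 := by
  refine ⟨fun i => ?_, fun i => ?_⟩ <;> rcases hz i with hi | hi <;> rw [hi]
  exacts [hu.1 i, hv.1 i, hu.2 i, hv.2 i]

namespace RegularPath

variable {n : ℕ} {C G : (Fin d → ℝ) → ℝ} {H Q : Fin d → ℝ → ℝ} {δ' B p ν μ η : ℝ}
  {c w L δ e K g : ℝ}

/-- The weighted bound when the smallest coordinate of `u` equals `g`. -/
lemma abs_le_of_coord_eq (h : RegularPath n C G H Q B p ν μ η δ') (hC : CopulaLike C)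
    (hS : ScaleBounds n c w p ν μ η B L δ e) (hδδ : 2 * δ ≤ δ') (hnδ : 1 / (n : ℝ) ≤ δ')
    (hd : 1 ≤ d) (hK : 0 < K) (hKL : 2 * K * d ≤ L)
    (hder : ∀ j : Fin d, ∀ u ∈ VV d j,
      HasDerivAt (fun t => C (Function.update u j t)) (Cdot C j u) (u j))
    (hbd : ∀ z ∈ Icc (0 : Fin d → ℝ) 1, ∀ j k, k ≠ j → z k ∈ Ioo (0 : ℝ) 1 →
      |Cdot C k z| ≤ K * z j / (z k * (1 - z k)))
    (hcg : c / n < g) (hgδ : g ≤ δ) {u : Fin d → ℝ} (hu : ∀ k, u k ∈ Ioc (0 : ℝ) 1)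
    {j : Fin d} (hj : u j = g) :
    |Real.sqrt n * (G (fun k => Q k (u k)) - C u)| ≤ (3 * d + 4) * e * g ^ w := by
  have hn0 : (0 : ℝ) < n := by exact_mod_cast hS.n_pos
  have hg0 : 0 < g := lt_of_le_of_lt (div_nonneg hS.c_mem.1.le hn0.le) hcg
  have he := hS.e_nonneg
  have hE : 0 ≤ e * g ^ w := mul_nonneg he (by positivity)
  have hr := (h.quantile j).r_pos
  have hw1 : w ≤ 1 := hS.w_lt_μ.le.trans hS.μ_le
  have hμ : 0 ≤ μ := hS.w_pos.le.trans hS.w_lt_μ.le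
  set v : Fin d → ℝ := fun k => Q k (u k) with hv
  have huI : u ∈ Icc (0 : Fin d → ℝ) 1 := ⟨fun k => (hu k).1.le, fun k => (hu k).2⟩
  have hvk : ∀ k, v k ∈ Icc (0 : ℝ) 1 := fun k => (h.quantile k).mem _ (hu k)
  have hvI : v ∈ Icc (0 : Fin d → ℝ) 1 := ⟨fun k => (hvk k).1, fun k => (hvk k).2⟩
  have hd0 : (1 : ℝ) ≤ d := by exact_mod_cast hd
  rcases le_or_gt g ν with hgν | hgν
  · have h1 := h.H_quantile_le hC hS.n_pos hS.η_nonneg hμ hnδ j (hu j)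
    have h2 := hS.η_mul_le hcg
    have h3 := hS.sqrt_div_le hcg
    have h4 := hS.sqrt_mul_le hw1 hg0 hgν
    have h5 := mul_le_mul_of_nonneg_left (h.le_margin v j) hr.le
    have h6 := mul_le_mul_of_nonneg_left (hC.le_coord u huI j) hr.le
    have h7 := mul_nonneg hr.le (h.nonneg v)
    have h8 := mul_nonneg hr.le (hC.nonneg u)
    rw [hj] at h1 h6
    have h9 : H j (v j) = H j (Q j g) := by rw [hv]; simp only [hj]
    rw [h9] at h5
    have h10 : 0 ≤ d * (e * g ^ w) := by positivity
    rw [abs_le]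
    constructor <;> nlinarith
  · have hg12 : g < 1 / 2 := hgδ.trans_lt hS.δ_lt
    have hvj : v j ≤ 2 * g := by
      have := (h.quantile j).le_two_mul hgν hg12
      simpa only [hv, hj] using this
    have hα : |Real.sqrt n * (G v - C v)| ≤ 2 * e * g ^ w := by
      have hI0 := update_mem_Icc hvI j (a := 0) ⟨le_rfl, zero_le_one⟩
      have hdist : dist v (Function.update v j 0) ≤ 2 * g := by
        refine (dist_update_le v j 0).trans ?_
        rw [sub_zero, abs_of_nonneg (hvk j).1]; exact hvj
      have hm := h.modulus v hvI _ hI0 (hdist.trans (by linarith))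
      have hC0 := hC.grounded (Function.update v j 0) j (by simp)
      have hG0 : G (Function.update v j 0) = 0 := by
        refine le_antisymm ?_ (h.nonneg _)
        refine (h.le_margin _ j).trans (le_of_eq ?_)
        simp [h.H_zero]
      rw [hC0, hG0, sub_zero, mul_zero, sub_zero] at hm
      exact hm.trans (hS.modulus_le hcg hgδ dist_nonneg hdist)
    have hinc : |Real.sqrt n * C v - Real.sqrt n * C u| ≤ ∑ _k : Fin d, 3 * e * g ^ w := by
      refine abs_sub_le_sum_of_coordwise (fun z => Real.sqrt n * C z) u v _ fun z hz k => ?_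
      have hzI := mix_mem_Icc huI hvI hz
      rw [← mul_sub, abs_mul, abs_of_pos hr]
      by_cases hkj : k = j
      · subst hkj
        refine (mul_le_mul_of_nonneg_left (hC.lip z hzI k _ (hvk k) _ (coord_mem_Icc huI k))
          hr.le).trans ?_
        exact (h.quantile k).mul_abs_sub_le (hu k) (Or.inl hj.le) hgν hgδ hS.w_pos.le
          hS.w_lt_p.le hS.small (hS.beta' (h.quantile k).B_nonneg (hg0.le.trans hgδ))
      · refine (h.quantile k).mul_abs_increment_le (f := fun s => C (Function.update z k s))
          (f' := fun s => Cdot C k (Function.update z k s)) (hu k)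
          (zero_le_one.trans hS.one_le_L) (fun a ha b hb => hC.lip z hzI k a ha b hb)
          (fun s hs => ?_) (fun s hs => ?_) hgν hgδ hS.w_pos.le
          hS.w_lt_p.le hS.small hS.beta
        · have := hder k (Function.update z k s)
            (mem_VV (update_mem_Icc hzI k (Ioo_subset_Icc_self hs)) (by simpa using hs))
          simpa using this
        · have := hbd (Function.update z k s)
            (update_mem_Icc hzI k (Ioo_subset_Icc_self hs)) j k hkj (by simpa using hs)
          rw [Function.update_self, Function.update_of_ne (Ne.symm hkj)] at this
          have hzj : z j ≤ 2 * g := by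
            rcases hz j with h1 | h1 <;> rw [h1]
            · linarith
            · exact hvj
          refine this.trans (div_le_div_of_nonneg_right ?_
            (mul_nonneg hs.1.le (by linarith [hs.2])))
          nlinarith [mul_le_mul_of_nonneg_left hzj hK.le, mul_le_mul_of_nonneg_left hd0 hK.le]
    simp only [Finset.sum_const, Finset.card_univ, Fintype.card_fin, nsmul_eq_mul] at hinc
    have hsplit : Real.sqrt n * (G v - C u) =
        Real.sqrt n * (G v - C v) + (Real.sqrt n * C v - Real.sqrt n * C u) := by ring
    rw [hsplit]
    refine (abs_add_le _ _).trans ((add_le_add hα hinc).trans ?_)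
    nlinarith

/-- The weighted bound when all coordinates of `u` but one exceed `1 - g`. -/
lemma abs_le_of_one_sub_le (h : RegularPath n C G H Q B p ν μ η δ') (hC : CopulaLike C)
    (hS : ScaleBounds n c w p ν μ η B L δ e) (hδδ : 2 * δ ≤ δ') (hnδ : 1 / (n : ℝ) ≤ δ')
    (hK : 0 < K) (hKL : 2 * K * d ≤ L)
    (hder : ∀ j : Fin d, ∀ u ∈ VV d j,
      HasDerivAt (fun t => C (Function.update u j t)) (Cdot C j u) (u j))
    (hbd : ∀ z ∈ Icc (0 : Fin d → ℝ) 1, ∀ j, z j ∈ Ioo (0 : ℝ) 1 →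
      |1 - Cdot C j z| ≤ K * (∑ k ∈ Finset.univ.erase j, (1 - z k)) / (z j * (1 - z j)))
    (hcg : c / n < g) (hgδ : g ≤ δ) {u : Fin d → ℝ} (hu : ∀ k, u k ∈ Ioc (0 : ℝ) 1)
    {j : Fin d} (hj : ∀ k, k ≠ j → 1 - g ≤ u k) :
    |Real.sqrt n * (G (fun k => Q k (u k)) - C u)| ≤ (3 * d + 4) * e * g ^ w := by
  have hn0 : (0 : ℝ) < n := by exact_mod_cast hS.n_pos
  have hg0 : 0 < g := lt_of_le_of_lt (div_nonneg hS.c_mem.1.le hn0.le) hcg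
  have he := hS.e_nonneg
  have hE : 0 ≤ e * g ^ w := mul_nonneg he (by positivity)
  have hr := (h.quantile j).r_pos
  have hw1 : w ≤ 1 := hS.w_lt_μ.le.trans hS.μ_le
  have hμ : 0 ≤ μ := hS.w_pos.le.trans hS.w_lt_μ.le
  set v : Fin d → ℝ := fun k => Q k (u k) with hv
  have huI : u ∈ Icc (0 : Fin d → ℝ) 1 := ⟨fun k => (hu k).1.le, fun k => (hu k).2⟩
  have hvk : ∀ k, v k ∈ Icc (0 : ℝ) 1 := fun k => (h.quantile k).mem _ (hu k)
  have hvI : v ∈ Icc (0 : Fin d → ℝ) 1 := ⟨fun k => (hvk k).1, fun k => (hvk k).2⟩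
  have hone : (1 : Fin d → ℝ) ∈ Icc (0 : Fin d → ℝ) 1 := ⟨zero_le_one, le_rfl⟩
  have hsum : ∀ (x : Fin d → ℝ) (b : ℝ), 0 ≤ b → (∀ k, k ≠ j → x k ≤ b) →
      ∑ k ∈ Finset.univ.erase j, x k ≤ d * b := fun x b hb hx => by
    calc ∑ k ∈ Finset.univ.erase j, x k ≤ ∑ _k ∈ Finset.univ.erase j, b :=
          Finset.sum_le_sum fun k hk => hx k (Finset.ne_of_mem_erase hk)
      _ ≤ ∑ _k : Fin d, b := Finset.sum_le_sum_of_subset_of_nonneg (Finset.erase_subset _ _)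
          fun _ _ _ => hb
      _ = d * b := by simp
  have hH1 := h.H_quantile_le hC hS.n_pos hS.η_nonneg hμ hnδ j (hu j)
  have hH2 := hS.η_mul_le hcg
  have hH3 := hS.sqrt_div_le hcg
  have hH4 := mul_le_mul_of_nonneg_left (h.le_H j _ (hu j)) hr.le
  rcases le_or_gt g ν with hgν | hgν
  · have h4 := hS.sqrt_mul_le hw1 hg0 hgν
    have h5 := mul_le_mul_of_nonneg_left (h.le_margin v j) hr.le
    have h6 := mul_le_mul_of_nonneg_left (hC.le_coord u huI j) hr.le
    have h7 := (h.sub_le_sum v j).trans (hsum (fun k => 1 - H k (v k)) g hg0.le fun k hk => by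
      have := h.le_H k _ (hu k)
      have := hj k hk
      simp only [hv]; linarith)
    have h8 := (hC.sub_le_sum huI j).trans (hsum (fun k => 1 - u k) g hg0.le fun k hk => by
      have := hj k hk
      linarith)
    have h7' := mul_le_mul_of_nonneg_left h7 hr.le
    have h8' := mul_le_mul_of_nonneg_left h8 hr.le
    have h9 : H j (v j) = H j (Q j (u j)) := rfl
    rw [h9] at h5 h7'
    have h10 : Real.sqrt n * (d * g) ≤ d * (e * g ^ w) := by
      calc Real.sqrt n * (d * g) = d * (Real.sqrt n * g) := by ring
        _ ≤ _ := by gcongr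
    have h11 : 0 ≤ d * (e * g ^ w) := by positivity
    rw [abs_le]
    constructor <;> nlinarith
  · have hg12 : g < 1 / 2 := hgδ.trans_lt hS.δ_lt
    have hvj : ∀ k, k ≠ j → 1 - v k ≤ 2 * g := fun k hk =>
      (h.quantile k).one_sub_le_two_mul hgν hg12 (hj k hk) (hu k).2
    have hα : |Real.sqrt n * (G v - C v) -
        Real.sqrt n * (G (Function.update 1 j (v j)) - C (Function.update 1 j (v j)))|
        ≤ 2 * e * g ^ w := by
      have hdist : dist v (Function.update 1 j (v j)) ≤ 2 * g := by
        refine (dist_pi_le_iff (by linarith)).2 fun k => ?_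
        by_cases hk : k = j
        · subst hk; simp [hg0.le]
        · rw [Function.update_of_ne hk, Pi.one_apply, Real.dist_eq, abs_sub_comm,
            abs_of_nonneg (by linarith [(hvk k).2])]
          exact hvj k hk
      exact (h.modulus v hvI _ (update_mem_Icc hone j (hvk j)) (hdist.trans (by linarith))).trans
        (hS.modulus_le hcg hgδ dist_nonneg hdist)
    rw [h.margin, hC.margin j _ (hvk j)] at hα
    have hinc : |Real.sqrt n * (C v - v j) - Real.sqrt n * (C u - u j)|
        ≤ ∑ _k : Fin d, 3 * e * g ^ w := by
      refine abs_sub_le_sum_of_coordwise (fun z => Real.sqrt n * (C z - z j)) u v _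
        fun z hz k => ?_
      have hzI := mix_mem_Icc huI hvI hz
      rw [← mul_sub, abs_mul, abs_of_pos hr]
      by_cases hkj : k = j
      · subst hkj
        have hmono : ∀ a ∈ Icc (0 : ℝ) 1, ∀ b ∈ Icc (0 : ℝ) 1, a ≤ b →
            C (Function.update z k a) ≤ C (Function.update z k b) := hC.mono_coord z hzI k
        have hlip : ∀ a ∈ Icc (0 : ℝ) 1, ∀ b ∈ Icc (0 : ℝ) 1,
            |(C (Function.update z k a) - a) - (C (Function.update z k b) - b)| ≤ |a - b| := by
          intro a ha b hb
          have h1 := hC.lip z hzI k a ha b hb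
          rcases le_total a b with hab | hab
          · have h2 := hmono a ha b hb hab
            rw [abs_of_nonpos (by linarith), abs_of_nonpos (by linarith)] at h1
            rw [abs_le, abs_of_nonpos (by linarith : a - b ≤ 0)]
            constructor <;> linarith
          · have h2 := hmono b hb a ha hab
            rw [abs_of_nonneg (by linarith), abs_of_nonneg (by linarith)] at h1
            rw [abs_le, abs_of_nonneg (by linarith : 0 ≤ a - b)]
            constructor <;> linarith
        have := (h.quantile k).mul_abs_increment_le
          (f := fun s => C (Function.update z k s) - s)
          (f' := fun s => Cdot C k (Function.update z k s) - 1) (hu k)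
          (zero_le_one.trans hS.one_le_L) hlip
          (fun s hs => ?_) (fun s hs => ?_) hgν hgδ hS.w_pos.le
          hS.w_lt_p.le hS.small hS.beta
        · simpa using this
        · have := hder k (Function.update z k s)
            (mem_VV (update_mem_Icc hzI k (Ioo_subset_Icc_self hs)) (by simpa using hs))
          simp only [Function.update_idem, Function.update_self] at this
          exact this.sub (hasDerivAt_id s)
        · have := hbd (Function.update z k s)
            (update_mem_Icc hzI k (Ioo_subset_Icc_self hs)) k (by simpa using hs)
          rw [Function.update_self, abs_sub_comm] at this
          refine this.trans (div_le_div_of_nonneg_right ?_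
            (mul_nonneg hs.1.le (by linarith [hs.2])))
          have h1 := hsum (fun i => 1 - Function.update z k s i) (2 * g) (by linarith)
            fun i hi => by
              rw [Function.update_of_ne hi]
              rcases hz i with h1 | h1 <;> rw [h1]
              · have := hj i hi; linarith
              · exact hvj i hi
          calc _ ≤ K * (d * (2 * g)) := mul_le_mul_of_nonneg_left h1 hK.le
            _ = 2 * K * d * g := by ring
            _ ≤ L * g := mul_le_mul_of_nonneg_right hKL hg0.le
      · simp only [Function.update_of_ne (Ne.symm hkj), sub_sub_sub_cancel_right]
        refine (mul_le_mul_of_nonneg_left (hC.lip z hzI k _ (hvk k) _ (coord_mem_Icc huI k))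
          hr.le).trans ?_
        exact (h.quantile k).mul_abs_sub_le (hu k) (Or.inr (by linarith [hj k hkj])) hgν hgδ
          hS.w_pos.le hS.w_lt_p.le hS.small
          (hS.beta' (h.quantile k).B_nonneg (hg0.le.trans hgδ))
    simp only [Finset.sum_const, Finset.card_univ, Fintype.card_fin, nsmul_eq_mul] at hinc
    have hsplit : Real.sqrt n * (G v - C u) =
        (Real.sqrt n * (G v - C v) - Real.sqrt n * (H j (v j) - v j)) +
        (Real.sqrt n * (C v - v j) - Real.sqrt n * (C u - u j)) +
        Real.sqrt n * (H j (v j) - u j) := by ring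
    have hjump : |Real.sqrt n * (H j (v j) - u j)| ≤ 2 * (e * g ^ w) := by
      rw [abs_of_nonneg (mul_nonneg hr.le (sub_nonneg.2 (h.le_H j _ (hu j))))]
      change Real.sqrt n * (H j (Q j (u j)) - u j) ≤ _
      linarith
    rw [hsplit]
    refine (abs_add_le _ _).trans ((add_le_add ((abs_add_le _ _).trans (add_le_add hα hinc))
      hjump).trans ?_)
    nlinarith

end RegularPath

lemma exists_coord_of_g1 (hd : 2 ≤ d) (u : Fin d → ℝ) :
    (∀ k, g1 u ≤ u k) ∧
      ((∃ j, u j = g1 u) ∨ ∃ j, ∀ k, k ≠ j → 1 - g1 u ≤ u k) := by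
  have : Nonempty (Fin d) := ⟨⟨0, by omega⟩⟩
  refine ⟨fun k => (min_le_left _ _).trans (ciInf_le (Set.finite_range _).bddBelow k), ?_⟩
  rcases min_choice (⨅ j, u j) (⨅ j : Fin d, (1 - ⨅ k : {k : Fin d // k ≠ j}, u (k : Fin d)))
    with h | h
  · left
    obtain ⟨j, hj⟩ := exists_eq_ciInf_of_finite (f := u)
    exact ⟨j, by rw [g1, h, hj]⟩
  · right
    obtain ⟨j, hj⟩ := exists_eq_ciInf_of_finite
      (f := fun j : Fin d => (1 - ⨅ k : {k : Fin d // k ≠ j}, u (k : Fin d)))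
    refine ⟨j, fun k hk => ?_⟩
    rw [g1, h, ← hj, sub_sub_cancel]
    exact ciInf_le (f := fun k : {k : Fin d // k ≠ j} => u (k : Fin d))
      (Set.finite_range _).bddBelow ⟨k, hk⟩

lemma indic_setOf {α : Type*} (p : α → Prop) [DecidablePred p] (x : α) :
    indic {y | p y} x = if p x then 1 else 0 := by
  simp [indic, indicator_apply]

section Probability

variable {P : Measure Ω} [IsProbabilityMeasure P] {X : ℤ → Ω → Fin d → ℝ}

lemma margF_mem_Icc (j : Fin d) (x : ℝ) : margF P X j x ∈ Icc (0 : ℝ) 1 :=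
  ⟨ENNReal.toReal_nonneg, measureReal_le_one⟩

lemma margF_mono (j : Fin d) : Monotone (margF P X j) := fun _ _ hab =>
  measureReal_mono fun _ hω => le_trans hω hab

lemma measurable_Uv (hmeas : ∀ i, Measurable (X i)) (i : ℤ) (j : Fin d) :
    Measurable fun ω => Uv P X i ω j :=
  (margF_mono j).measurable.comp ((measurable_pi_apply j).comp (hmeas i))

/-- Probability integral transform. -/
lemma measureReal_Uv_le (hmeas : ∀ i, Measurable (X i)) (hcont : ∀ j, Continuous (margF P X j))
    (j : Fin d) {s : ℝ} (hs : s ∈ Icc (0 : ℝ) 1) :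
    P.real {ω | Uv P X 0 ω j ≤ s} = s := by
  have hm : Measurable fun ω => X 0 ω j := (measurable_pi_apply j).comp (hmeas 0)
  have := Measure.isProbabilityMeasure_map (μ := P) hm.aemeasurable
  have hF : margF P X j = ProbabilityTheory.cdf (P.map fun ω => X 0 ω j) := by
    funext x
    rw [ProbabilityTheory.cdf_eq_real, map_measureReal_apply hm measurableSet_Iic]
    rfl
  have hivt : ∀ t ∈ Ioo (0 : ℝ) 1, ∃ x, margF P X j x = t := by
    intro t ht
    have h0 : ∃ a, margF P X j a < t := by
      have := ProbabilityTheory.tendsto_cdf_atBot (P.map fun ω => X 0 ω j)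
      rw [← hF] at this
      exact (this.eventually (eventually_lt_nhds ht.1)).exists
    have h1 : ∃ b, t < margF P X j b := by
      have := ProbabilityTheory.tendsto_cdf_atTop (P.map fun ω => X 0 ω j)
      rw [← hF] at this
      exact (this.eventually (eventually_gt_nhds ht.2)).exists
    obtain ⟨a, ha⟩ := h0
    obtain ⟨b, hb⟩ := h1
    exact mem_range_of_exists_le_of_exists_ge (hcont j) ⟨a, ha.le⟩ ⟨b, hb.le⟩
  apply le_antisymm
  · refine le_of_forall_gt_imp_ge_of_dense fun t hst => ?_
    rcases lt_or_ge t 1 with ht1 | ht1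
    · obtain ⟨x, hx⟩ := hivt t ⟨hs.1.trans_lt hst, ht1⟩
      rw [← hx]
      refine measureReal_mono fun ω hω => ?_
      change X 0 ω j ≤ x
      by_contra hlt
      have h1 := margF_mono (P := P) (X := X) j (not_le.1 hlt).le
      have h2 : margF P X j (X 0 ω j) ≤ s := hω
      linarith
    · exact measureReal_le_one.trans ht1
  · refine le_of_forall_lt_imp_le_of_dense fun t hst => ?_
    rcases le_or_gt t 0 with ht0 | ht0
    · exact ht0.trans measureReal_nonneg
    · obtain ⟨x, hx⟩ := hivt t ⟨ht0, hst.trans_le hs.2⟩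
      rw [← hx]
      refine measureReal_mono fun ω hω => ?_
      have h1 : margF P X j (X 0 ω j) ≤ margF P X j x := margF_mono j hω
      change margF P X j (X 0 ω j) ≤ s
      linarith

lemma copulaLike_cop (hmeas : ∀ i, Measurable (X i)) (hcont : ∀ j, Continuous (margF P X j)) :
    CopulaLike (cop P X) := by
  have hmono : ∀ (z : Fin d → ℝ) (k : Fin d) (a b : ℝ), a ≤ b →
      cop P X (Function.update z k a) ≤ cop P X (Function.update z k b) := by
    intro z k a b hab
    refine measureReal_mono fun ω hω i => (hω i).trans ?_
    by_cases hi : i = k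
    · subst hi; simpa using hab
    · simp [hi]
  have hinc : ∀ (z : Fin d → ℝ) (k : Fin d), ∀ a ∈ Icc (0 : ℝ) 1, ∀ b ∈ Icc (0 : ℝ) 1, a ≤ b →
      cop P X (Function.update z k b) - cop P X (Function.update z k a) ≤ b - a := by
    intro z k a ha b hb hab
    have h1 : P.real {ω | Uv P X 0 ω k ≤ b} - P.real {ω | Uv P X 0 ω k ≤ a} = b - a := by
      rw [measureReal_Uv_le hmeas hcont k ha, measureReal_Uv_le hmeas hcont k hb]
    have hsub : {ω | Uv P X 0 ω k ≤ a} ⊆ {ω | Uv P X 0 ω k ≤ b} := fun ω hω => le_trans hω hab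
    rw [← h1, ← measureReal_sdiff hsub (measurableSet_le (measurable_Uv hmeas 0 k)
      measurable_const), sub_le_iff_le_add]
    refine le_trans (measureReal_mono ?_) (measureReal_union_le _ _)
    intro ω hω
    by_cases hω' : Uv P X 0 ω k ≤ a
    · right
      intro i
      by_cases hi : i = k
      · subst hi; simpa using hω'
      · have := hω i
        simpa [hi] using this
    · left
      exact ⟨by simpa using hω k, hω'⟩
  refine ⟨fun z _ k a ha b hb => ?_, fun z _ k a _ b _ hab => hmono z k a b hab,
    fun z => ENNReal.toReal_nonneg, fun z j hj => ?_, fun z hz j => ?_, fun j t ht => ?_⟩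
  · rcases le_total a b with hab | hab
    · rw [abs_sub_comm, abs_sub_comm a, abs_of_nonneg (sub_nonneg.2 (hmono z k a b hab)),
        abs_of_nonneg (sub_nonneg.2 hab)]
      exact hinc z k a ha b hb hab
    · rw [abs_of_nonneg (sub_nonneg.2 (hmono z k b a hab)), abs_of_nonneg (sub_nonneg.2 hab)]
      exact hinc z k b hb a ha hab
  · refine le_antisymm ?_ ENNReal.toReal_nonneg
    rw [← measureReal_Uv_le (P := P) (X := X) hmeas hcont j (s := 0) ⟨le_rfl, zero_le_one⟩]
    exact measureReal_mono fun ω hω => (hω j).trans hj.le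
  · rw [← measureReal_Uv_le (P := P) (X := X) hmeas hcont j (coord_mem_Icc hz j)]
    exact measureReal_mono fun ω hω => hω j
  · refine Eq.trans ?_ (measureReal_Uv_le (P := P) (X := X) hmeas hcont j ht)
    change P.real _ = _
    congr 1
    ext ω
    refine ⟨fun hω => by simpa using hω j, fun hω i => ?_⟩
    by_cases hi : i = j
    · subst hi
      rw [Function.update_self]
      exact hω
    · rw [Function.update_of_ne hi]
      exact (margF_mem_Icc i _).2

lemma ae_Uv_pos (hmeas : ∀ i, Measurable (X i)) (hstat : StrictlyStationary P X)
    (hcont : ∀ j, Continuous (margF P X j)) : ∀ᵐ ω ∂P, ∀ i j, 0 < Uv P X i ω j := by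
  rw [ae_all_iff]
  intro i
  rw [ae_all_iff]
  intro j
  have h0 := measureReal_Uv_le (P := P) (X := X) hmeas hcont j (s := 0) ⟨le_rfl, zero_le_one⟩
  rw [measureReal_eq_zero_iff] at h0
  have hA : MeasurableSet {y : Fin 1 → Fin d → ℝ | margF P X j (y 0 j) ≤ 0} :=
    measurableSet_le ((hcont j).measurable.comp
      ((measurable_pi_apply j).comp (measurable_pi_apply 0))) measurable_const
  have hst := congrArg (fun ν => ν {y : Fin 1 → Fin d → ℝ | margF P X j (y 0 j) ≤ 0})
    (hstat 1 (fun _ => 0) i)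
  beta_reduce at hst
  rw [Measure.map_apply (measurable_pi_lambda _ fun _ => hmeas _) hA,
    Measure.map_apply (measurable_pi_lambda _ fun _ => hmeas _) hA] at hst
  rw [ae_iff]
  refine Eq.trans ?_ (hst.trans h0)
  congr 1
  ext ω
  simp [Uv]

end Probability

section Empirical

variable (P : Measure Ω) (X : ℤ → Ω → Fin d → ℝ)

lemma Gn_nonneg (n : ℕ) (z : Fin d → ℝ) (ω : Ω) : 0 ≤ Gn P X n z ω := by
  classical
  simp only [Gn, indic_setOf]
  exact mul_nonneg (by positivity) (Finset.sum_nonneg fun i _ => by split_ifs <;> norm_num)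

lemma Gn_le_Gnj (n : ℕ) (z : Fin d → ℝ) (j : Fin d) (ω : Ω) :
    Gn P X n z ω ≤ Gnj P X n j (z j) ω := by
  classical
  simp only [Gn, Gnj, indic_setOf]
  refine mul_le_mul_of_nonneg_left (Finset.sum_le_sum fun i _ => ?_) (by positivity)
  by_cases h : ∀ k, Uv P X i ω k ≤ z k
  · rw [if_pos h, if_pos (h j)]
  · rw [if_neg h]; split_ifs <;> norm_num

lemma one_sub_Gnj {n : ℕ} (hn : 1 ≤ n) (j : Fin d) (s : ℝ) (ω : Ω) :
    1 - Gnj P X n j s ω =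
      (n : ℝ)⁻¹ * ∑ i ∈ Finset.Icc (1 : ℤ) n, (1 - indic {ω' | Uv P X i ω' j ≤ s} ω) := by
  have hn0 : (n : ℝ) ≠ 0 := by positivity
  rw [Gnj, Finset.sum_sub_distrib, mul_sub]
  simp [hn0]

lemma Gnj_sub_Gn_le {n : ℕ} (hn : 1 ≤ n) (z : Fin d → ℝ) (j : Fin d) (ω : Ω) :
    Gnj P X n j (z j) ω - Gn P X n z ω
      ≤ ∑ k ∈ Finset.univ.erase j, (1 - Gnj P X n k (z k) ω) := by
  classical
  simp only [one_sub_Gnj P X hn]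
  rw [← Finset.mul_sum, Finset.sum_comm, Gn, Gnj, ← mul_sub, ← Finset.sum_sub_distrib]
  refine mul_le_mul_of_nonneg_left (Finset.sum_le_sum fun i _ => ?_) (by positivity)
  simp only [indic_setOf]
  have hnn : ∀ k ∈ Finset.univ.erase j,
      (0 : ℝ) ≤ 1 - if Uv P X i ω k ≤ z k then 1 else 0 := fun k _ => by
    split_ifs <;> norm_num
  by_cases h : ∀ k, Uv P X i ω k ≤ z k
  · rw [if_pos h, if_pos (h j), sub_self]
    exact Finset.sum_nonneg hnn
  · rw [if_neg h, sub_zero]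
    split_ifs with hj
    · push Not at h
      obtain ⟨k, hk⟩ := h
      have hkj : k ∈ Finset.univ.erase j := by
        refine Finset.mem_erase.2 ⟨?_, Finset.mem_univ k⟩
        rintro rfl
        linarith
      refine le_trans (le_of_eq ?_) (Finset.single_le_sum hnn hkj)
      rw [if_neg (not_le.2 hk), sub_zero]
    · exact Finset.sum_nonneg hnn

lemma Gnj_eq_zero {n : ℕ} {j : Fin d} {x : ℝ} {ω : Ω} (h : ∀ i, x < Uv P X i ω j) :
    Gnj P X n j x ω = 0 := by
  classical
  simp only [Gnj, indic_setOf]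
  rw [Finset.sum_eq_zero, mul_zero]
  exact fun i _ => if_neg (not_le.2 (h i))

lemma upperSemicontinuous_Gnj (n : ℕ) (j : Fin d) (ω : Ω) :
    UpperSemicontinuous fun x => Gnj P X n j x ω := by
  classical
  have h : ∀ i, UpperSemicontinuous fun x : ℝ =>
      (n : ℝ)⁻¹ * indic {ω' | Uv P X i ω' j ≤ x} ω := by
    intro i
    have := (isClosed_Ici (a := Uv P X i ω j)).upperSemicontinuous_indicator
      (y := (n : ℝ)⁻¹) (by positivity)
    convert this using 2 with x
    simp [indic_setOf, indicator_apply]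
  have h2 := upperSemicontinuous_sum (a := Finset.Icc (1 : ℤ) n) (fun i _ => h i)
  have h3 : (fun x => Gnj P X n j x ω) = fun x =>
      ∑ i ∈ Finset.Icc (1 : ℤ) n, (n : ℝ)⁻¹ * indic {ω' | Uv P X i ω' j ≤ x} ω :=
    funext fun x => by simp only [Gnj, Finset.mul_sum]
  rw [h3]
  exact h2

variable {P X} in
lemma genInv_Gnj_eq {n : ℕ} {j : Fin d} {ω : Ω} {s : ℝ}
    (hs : s ∈ Ioc (0 : ℝ) 1) :
    genInv (fun x => Gnj P X n j x ω) s = sInf {x | s ≤ Gnj P X n j x ω} :=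
  if_neg hs.1.ne'

variable {P X} in
lemma nonneg_of_mem_superlevel {n : ℕ} {j : Fin d} {ω : Ω} {s : ℝ}
    (hpos : ∀ i j, 0 < Uv P X i ω j)
    (hs : s ∈ Ioc (0 : ℝ) 1) {x : ℝ}
    (hx : x ∈ {x | s ≤ Gnj P X n j x ω}) : 0 ≤ x := by
  by_contra hlt
  have h0 : Gnj P X n j x ω = 0 :=
    Gnj_eq_zero P X fun i => (not_le.1 hlt).trans (hpos i j)
  have h1 : s ≤ Gnj P X n j x ω := hx
  linarith [hs.1]

variable {P X} in
lemma Gnj_lt_of_lt_genInv {n : ℕ} {j : Fin d} {ω : Ω} {s : ℝ}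
    (hpos : ∀ i j, 0 < Uv P X i ω j)
    (hs : s ∈ Ioc (0 : ℝ) 1) {x : ℝ}
    (hx : x < genInv (fun x => Gnj P X n j x ω) s) : Gnj P X n j x ω < s := by
  rw [genInv_Gnj_eq hs] at hx
  by_contra hle
  exact absurd (csInf_le ⟨0, fun x hx => nonneg_of_mem_superlevel hpos hs hx⟩
    (show x ∈ {x | s ≤ Gnj P X n j x ω} from not_lt.1 hle)) (not_le.2 hx)

variable [IsProbabilityMeasure P]

lemma Gnj_one {n : ℕ} (hn : 1 ≤ n) (j : Fin d) (ω : Ω) : Gnj P X n j 1 ω = 1 := by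
  classical
  have hn0 : (n : ℝ) ≠ 0 := by positivity
  have h : ∀ i, Uv P X i ω j ≤ 1 := fun i => (margF_mem_Icc j (X i ω j)).2
  simp [Gnj, indic_setOf, h, hn0]

lemma Gn_update_one (n : ℕ) (j : Fin d) (t : ℝ) (ω : Ω) :
    Gn P X n (Function.update 1 j t) ω = Gnj P X n j t ω := by
  have h : ∀ i, {ω' | ∀ k, Uv P X i ω' k ≤ Function.update (1 : Fin d → ℝ) j t k}
      = {ω' | Uv P X i ω' j ≤ t} := by
    intro i
    ext ω'
    refine ⟨fun hω => by simpa using hω j, fun hω k => ?_⟩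
    by_cases hk : k = j
    · subst hk
      rw [Function.update_self]
      exact hω
    · rw [Function.update_of_ne hk]
      exact (margF_mem_Icc k _).2
  simp only [Gn, Gnj, h]

lemma abs_alphan_le {n : ℕ} (z : Fin d → ℝ) (ω : Ω) : |alphan P X n z ω| ≤ Real.sqrt n := by
  classical
  have h1 : Gn P X n z ω ≤ 1 := by
    simp only [Gn, indic_setOf]
    rcases Nat.eq_zero_or_pos n with rfl | hn
    · simp
    have hn0 : (0 : ℝ) < n := by exact_mod_cast hn
    rw [inv_mul_le_iff₀ hn0]
    refine (Finset.sum_le_sum (g := fun _ => (1 : ℝ)) fun i _ => ?_).trans (by simp)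
    split_ifs <;> norm_num
  have h2 := Gn_nonneg P X n z ω
  have h3 : 0 ≤ cop P X z := ENNReal.toReal_nonneg
  have h4 : cop P X z ≤ 1 := measureReal_le_one
  rw [alphan, abs_mul, abs_of_nonneg (Real.sqrt_nonneg _)]
  exact mul_le_of_le_one_right (Real.sqrt_nonneg _) (abs_le.2 ⟨by linarith, by linarith⟩)

section Quantile

variable {P X} {n : ℕ} {j : Fin d} {ω : Ω} {s : ℝ}

lemma one_mem_superlevel (hn : 1 ≤ n) (hs : s ∈ Ioc (0 : ℝ) 1) : (1 : ℝ) ∈ {x | s ≤ Gnj P X n j x ω} := by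
  change s ≤ Gnj P X n j 1 ω
  rw [Gnj_one P X hn]; exact hs.2

lemma genInv_Gnj_mem (hn : 1 ≤ n) (hpos : ∀ i j, 0 < Uv P X i ω j)
    (hs : s ∈ Ioc (0 : ℝ) 1) :
    genInv (fun x => Gnj P X n j x ω) s ∈ Icc (0 : ℝ) 1 := by
  rw [genInv_Gnj_eq hs]
  exact ⟨Real.sInf_nonneg fun x hx => nonneg_of_mem_superlevel hpos hs hx,
    csInf_le ⟨0, fun x hx => nonneg_of_mem_superlevel hpos hs hx⟩
      (one_mem_superlevel hn hs)⟩

lemma genInv_Gnj_mono (hn : 1 ≤ n) (hpos : ∀ i j, 0 < Uv P X i ω j)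
    {t : ℝ}
    (hs : s ∈ Ioc (0 : ℝ) 1) (ht : t ∈ Ioc (0 : ℝ) 1) (hst : s ≤ t) :
    genInv (fun x => Gnj P X n j x ω) s ≤ genInv (fun x => Gnj P X n j x ω) t := by
  rw [genInv_Gnj_eq hs, genInv_Gnj_eq ht]
  exact csInf_le_csInf ⟨0, fun x hx => nonneg_of_mem_superlevel hpos hs hx⟩
    ⟨1, one_mem_superlevel hn ht⟩ fun x hx => hst.trans hx

lemma le_Gnj_genInv (hn : 1 ≤ n) (hpos : ∀ i j, 0 < Uv P X i ω j)
    (hs : s ∈ Ioc (0 : ℝ) 1) :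
    s ≤ Gnj P X n j (genInv (fun x => Gnj P X n j x ω) s) ω := by
  rw [genInv_Gnj_eq hs]
  have hcl : IsClosed {x | s ≤ Gnj P X n j x ω} :=
    (upperSemicontinuous_Gnj P X n j ω).isClosed_preimage s
  exact hcl.csInf_mem ⟨1, one_mem_superlevel hn hs⟩
    ⟨0, fun x hx => nonneg_of_mem_superlevel hpos hs hx⟩

end Quantile

end Empirical

lemma le_biSup_of_le {α : Type*} {S : Set α} {f : α → ℝ} {M : ℝ} (hM : ∀ x ∈ S, f x ≤ M)
    {x : α} (hx : x ∈ S) : f x ≤ ⨆ s ∈ S, f s := by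
  have hb : BddAbove (range fun s => ⨆ (_ : s ∈ S), f s) := by
    refine ⟨max M 0, ?_⟩
    rintro _ ⟨s, rfl⟩
    by_cases hs : s ∈ S
    · simpa [hs] using Or.inl (hM s hs)
    · simp [hs]
  refine le_trans (le_of_eq ?_) (le_ciSup hb x)
  simp [hx]

lemma biSup_le_of_le {α : Type*} {S : Set α} {f : α → ℝ} {M : ℝ} (h0 : 0 ≤ M)
    (hM : ∀ x ∈ S, f x ≤ M) : ⨆ s ∈ S, f s ≤ M :=
  Real.iSup_le (fun x => Real.iSup_le (fun hx => hM x hx) h0) h0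

lemma biSup_nonneg {α : Type*} {S : Set α} {f : α → ℝ} (h : ∀ x ∈ S, 0 ≤ f x) :
    0 ≤ ⨆ s ∈ S, f s :=
  Real.iSup_nonneg fun x => Real.iSup_nonneg fun hx => h x hx

/-- On the event where the quantile processes and the modulus of continuity are controlled, the
realization of the empirical process is a regular path. -/
lemma regularPath_of_bounds {P : Measure Ω} [IsProbabilityMeasure P] {X : ℤ → Ω → Fin d → ℝ}
    {n : ℕ} {ω : Ω} {B p ν μ η δ' : ℝ} (hn : 1 ≤ n) (hpos : ∀ i j, 0 < Uv P X i ω j)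
    (hB : 0 ≤ B) (hp : p ∈ Ioo (0 : ℝ) 1) (hν : 0 < ν) (hν' : ν ≤ 1 / 8)
    (hscale : B / Real.sqrt n * ν ^ (p - 1) ≤ 1 / 2)
    (hβ : ∀ k, |⨆ s ∈ Ioo ν (1 - ν), |betanj P X n k s ω| / (s * (1 - s)) ^ p| ≤ B)
    (hM : |Mn P X n δ' μ ω| ≤ η) :
    RegularPath n (cop P X) (fun z => Gn P X n z ω) (fun k x => Gnj P X n k x ω)
      (fun k => genInv fun x => Gnj P X n k x ω) B p ν μ η δ' := by
  have hn0 : (0 : ℝ) < n := by exact_mod_cast hn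
  have hr : 0 < Real.sqrt n := Real.sqrt_pos.2 hn0
  refine ⟨fun k => ⟨fun s hs => genInv_Gnj_mem hn hpos hs,
      fun s hs t ht hst => genInv_Gnj_mono hn hpos hs ht hst, fun s hs => ?_, hr, hB, hp, hν, hν',
      hscale⟩,
    fun k s hs => le_Gnj_genInv hn hpos hs, fun k s hs x hx => Gnj_lt_of_lt_genInv hpos hs hx,
    fun k => Gnj_eq_zero P X fun i => hpos i k, fun z => Gn_nonneg P X n z ω,
    fun z j => Gn_le_Gnj P X n z j ω, fun z j => Gnj_sub_Gn_le P X hn z j ω,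
    fun j t => Gn_update_one P X n j t ω, fun z hz y hy hzy => ?_⟩
  · have hbdd : ∀ t ∈ Ioo ν (1 - ν),
        |betanj P X n k t ω| / (t * (1 - t)) ^ p ≤ Real.sqrt n / (ν * ν) ^ p := by
      intro t ht
      have ht0 : t ∈ Ioc (0 : ℝ) 1 := ⟨hν.trans ht.1, by linarith [ht.2]⟩
      have hm := genInv_Gnj_mem (P := P) (X := X) (j := k) hn hpos ht0
      refine div_le_div₀ hr.le ?_ (by positivity) ?_
      · rw [betanj, abs_mul, abs_of_pos hr]
        exact mul_le_of_le_one_right hr.le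
          (abs_le.2 ⟨by linarith [hm.1, ht0.2], by linarith [hm.2, ht0.1]⟩)
      · exact Real.rpow_le_rpow (by positivity)
          (mul_le_mul ht.1.le (by linarith [ht.2]) hν.le ht0.1.le) hp.1.le
    have h1 := (le_biSup_of_le hbdd hs).trans ((le_abs_self _).trans (hβ k))
    have hx : 0 < s * (1 - s) := mul_pos (hν.trans hs.1) (by linarith [hs.2])
    rwa [div_le_iff₀ (Real.rpow_pos_of_pos hx p), betanj, abs_mul, abs_of_pos hr] at h1
  · have hden : ∀ t : ℝ, 0 < max t ((n : ℝ) ^ (-μ)) := fun t =>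
      lt_max_of_lt_right (Real.rpow_pos_of_pos hn0 _)
    have hbdd : ∀ q ∈ {q : (Fin d → ℝ) × (Fin d → ℝ) |
        q.1 ∈ Set.Icc 0 1 ∧ q.2 ∈ Set.Icc 0 1 ∧ dist q.1 q.2 ≤ δ'},
        |alphan P X n q.1 ω - alphan P X n q.2 ω| / max (dist q.1 q.2 ^ μ) ((n : ℝ) ^ (-μ))
          ≤ (Real.sqrt n + Real.sqrt n) / (n : ℝ) ^ (-μ) := by
      intro q _
      refine div_le_div₀ (by positivity) ?_ (Real.rpow_pos_of_pos hn0 _) (le_max_right _ _)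
      exact (abs_sub _ _).trans (add_le_add (abs_alphan_le P X _ ω) (abs_alphan_le P X _ ω))
    have h1 := (le_biSup_of_le hbdd (x := (z, y)) ⟨hz, hy, hzy⟩).trans
      ((le_abs_self _).trans hM)
    rwa [div_le_iff₀ (hden _)] at h1

lemma abs_biSup_CPgi_le {P : Measure Ω} [IsProbabilityMeasure P] {X : ℤ → Ω → Fin d → ℝ}
    {n : ℕ} {ω : Ω} {c w p ν μ η B L δ δ' e K : ℝ} (hd : 2 ≤ d)
    (hcop : CopulaLike (cop P X))
    (h : RegularPath n (cop P X) (fun z => Gn P X n z ω) (fun k x => Gnj P X n k x ω)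
      (fun k => genInv fun x => Gnj P X n k x ω) B p ν μ η δ')
    (hS : ScaleBounds n c w p ν μ η B L δ e) (hδδ : 2 * δ ≤ δ') (hnδ : 1 / (n : ℝ) ≤ δ')
    (hK : 0 < K) (hKL : 2 * K * d ≤ L)
    (hder : ∀ j : Fin d, ∀ u ∈ VV d j,
      HasDerivAt (fun t => cop P X (Function.update u j t)) (Cdot (cop P X) j u) (u j))
    (hlow : ∀ z ∈ Icc (0 : Fin d → ℝ) 1, ∀ j k, k ≠ j → z k ∈ Ioo (0 : ℝ) 1 →
      |Cdot (cop P X) k z| ≤ K * z j / (z k * (1 - z k)))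
    (hupp : ∀ z ∈ Icc (0 : Fin d → ℝ) 1, ∀ j, z j ∈ Ioo (0 : ℝ) 1 →
      |1 - Cdot (cop P X) j z| ≤
        K * (∑ k ∈ Finset.univ.erase j, (1 - z k)) / (z j * (1 - z j))) :
    |(⨆ u ∈ NN d (c / n) δ, |CPgi P X n u ω / gW w u|)| ≤ (3 * d + 4) * e := by
  have he := hS.e_nonneg
  rw [abs_of_nonneg (biSup_nonneg fun u _ => abs_nonneg _)]
  refine biSup_le_of_le (by positivity) fun u hu => ?_
  obtain ⟨hu01, hcg, hgδ⟩ := hu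
  have hg0 : 0 < g1 u := lt_of_le_of_lt (div_nonneg hS.c_mem.1.le (Nat.cast_nonneg n)) hcg
  obtain ⟨hgu, hcases⟩ := exists_coord_of_g1 hd u
  have hu' : ∀ k, u k ∈ Ioc (0 : ℝ) 1 := fun k => ⟨hg0.trans_le (hgu k), (hu01 k).2⟩
  have hmain : |CPgi P X n u ω| ≤ (3 * d + 4) * e * g1 u ^ w := by
    rcases hcases with ⟨j, hj⟩ | ⟨j, hj⟩
    · exact h.abs_le_of_coord_eq hcop hS hδδ hnδ (by omega) hK hKL hder hlow hcg hgδ hu' hj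
    · exact h.abs_le_of_one_sub_le hcop hS hδδ hnδ hK hKL hder hupp hcg hgδ hu' hj
  have hgw : 0 < gW w u := Real.rpow_pos_of_pos hg0 w
  rwa [abs_div, abs_of_pos hgw, div_le_iff₀ hgw]

lemma tendsto_natCast_rpow_neg {a : ℝ} (ha : a < 0) :
    Tendsto (fun n : ℕ => (n : ℝ) ^ a) atTop (nhds 0) := by
  have := (tendsto_rpow_neg_atTop (y := -a) (by linarith)).comp tendsto_natCast_atTop_atTop
  simpa [Function.comp_def] using this

lemma eventually_scaleBounds {δ : ℕ → ℝ} {c w p μ lam η B L e : ℝ} (hc : c ∈ Ioo (0 : ℝ) 1)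
    (hw : 0 < w) (hwp : w < p) (hwμ : w < μ) (hμ : μ ≤ 1) (hw2 : w < 1 / 2) (hη : 0 ≤ η)
    (hηe : η / c ≤ e) (he : 0 < e) (hL : 1 ≤ L) (hlam : 0 < lam)
    (hlw : 1 / 2 < lam * (1 - w)) (hlp : lam * (1 - p) < 1 / 2)
    (hδ : Tendsto δ atTop (nhds 0)) :
    ∀ᶠ n : ℕ in atTop, ScaleBounds n c w p ((n : ℝ) ^ (-lam)) μ η B L (δ n) e ∧
      (n : ℝ) ^ (-lam) ≤ 1 / 8 ∧ B / Real.sqrt n * ((n : ℝ) ^ (-lam)) ^ (p - 1) ≤ 1 / 2 := by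
  have h1 : ∀ᶠ n : ℕ in atTop, (n : ℝ) ^ (-lam) ≤ 1 / 8 :=
    (tendsto_natCast_rpow_neg (by linarith)).eventually_le_const (by norm_num)
  have h2 : ∀ᶠ n : ℕ in atTop, (n : ℝ) ^ (1 / 2 - lam * (1 - w)) ≤ e :=
    (tendsto_natCast_rpow_neg (by linarith)).eventually_le_const he
  have h3 : ∀ᶠ n : ℕ in atTop, (n : ℝ) ^ (w - 1 / 2) / c ≤ e := by
    have := (tendsto_natCast_rpow_neg (a := w - 1 / 2) (by linarith)).div_const c
    rw [zero_div] at this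
    exact this.eventually_le_const he
  have h4 : ∀ᶠ n : ℕ in atTop, B * (n : ℝ) ^ (-(1 / 2) + lam * (1 - p)) ≤ 1 / 2 := by
    have := (tendsto_natCast_rpow_neg (a := -(1 / 2) + lam * (1 - p)) (by linarith)).const_mul B
    rw [mul_zero] at this
    exact this.eventually_le_const (by norm_num)
  have h5 : ∀ᶠ n : ℕ in atTop, B * (4 * L) ^ p * δ n ^ (p - w) ≤ e := by
    have := (hδ.rpow_const (p := p - w) (Or.inr (by linarith))).const_mul (B * (4 * L) ^ p)
    rw [Real.zero_rpow (by linarith), mul_zero] at this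
    exact this.eventually_le_const he
  filter_upwards [h1, h2, h3, h4, h5, hδ.eventually_lt_const (show (0 : ℝ) < 1 / 2 by norm_num),
    eventually_ge_atTop 1] with n h1 h2 h3 h4 h5 h6 hn
  have hn0 : (0 : ℝ) < n := by exact_mod_cast hn
  refine ⟨⟨hn, hc, hw, hwp, hwμ, hμ, hη, hL, h6, ?_, hηe, h3, h5⟩, h1, ?_⟩
  · rw [Real.sqrt_eq_rpow, ← Real.rpow_mul hn0.le, ← Real.rpow_add hn0]
    convert h2 using 2
    ring
  · rw [Real.sqrt_eq_rpow, ← Real.rpow_mul hn0.le, div_eq_mul_inv, ← Real.rpow_neg hn0.le,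
      mul_assoc, ← Real.rpow_add hn0]
    convert h4 using 3
    ring

lemma half_div_one_sub_le {θ : ℝ} (hθ : θ ∈ Ioc (0 : ℝ) (1 / 2)) : θ / (2 * (1 - θ)) ≤ θ := by
  have h := hθ.2
  have h0 := hθ.1
  rw [div_le_iff₀ (by linarith)]
  nlinarith

/-- Admissible auxiliary exponents for the weights of the quantile process, for the modulus of
continuity and for the excluded boundary regions. -/
lemma exists_exponents {θ₁ θ₂ θ₃ w : ℝ} (hθ₁ : θ₁ ∈ Ioc (0 : ℝ) (1 / 2))
    (hθ₂ : θ₂ ∈ Ioc (0 : ℝ) (1 / 2)) (hw : 0 < w) (hw1 : w < θ₁ / (2 * (1 - θ₁)))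
    (hw2 : w < θ₂ / (2 * (1 - θ₂))) (hw3 : w < θ₃ - 1 / 2) :
    ∃ p μ lam : ℝ, p ∈ Ioo w θ₂ ∧ μ ∈ Ioo w θ₁ ∧ lam ∈ Ioo 0 θ₃ ∧
      1 / 2 < lam * (1 - w) ∧ lam * (1 - p) < 1 / 2 := by
  have hw1' : w < θ₁ := hw1.trans_le (half_div_one_sub_le hθ₁)
  have hw2' : w < θ₂ := hw2.trans_le (half_div_one_sub_le hθ₂)
  have h1 := hθ₁.2
  have h2 := hθ₂.2
  have hpos : 0 < 1 - w := by linarith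
  have hlt3 : 1 / (2 * (1 - w)) < θ₃ := by
    rw [div_lt_iff₀ (by linarith)]
    nlinarith
  have hltp : 1 / (2 * (1 - w)) < 1 / (2 * (1 - (w + θ₂) / 2)) :=
    one_div_lt_one_div_of_lt (by linarith) (by linarith)
  obtain ⟨lam, hl1, hl2⟩ := exists_between (lt_min hlt3 hltp)
  have hl3 := hl2.trans_le (min_le_left _ _)
  have hl4 := hl2.trans_le (min_le_right _ _)
  rw [div_lt_iff₀ (by linarith)] at hl1
  rw [lt_div_iff₀ (by linarith)] at hl4
  have hl0 : 0 < lam := by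
    by_contra hneg
    nlinarith
  exact ⟨(w + θ₂) / 2, (w + θ₁) / 2, lam, ⟨by linarith, by linarith⟩,
    ⟨by linarith, by linarith⟩, ⟨hl0, hl3⟩, by linarith, by linarith⟩

/-- Lemma 4.8: the weighted process `𝔺_n/g_ω` is uniformly negligible on the
boundary region `N(c/n, δ_n)`. -/
theorem weighted_CPgi_negligible_near_boundary
    {Ω : Type*} [MeasurableSpace Ω] {d : ℕ} (hd : 2 ≤ d)
    (P : Measure Ω) [IsProbabilityMeasure P] (X : ℤ → Ω → Fin d → ℝ)
    (hmeas : ∀ i, Measurable (X i)) (hstat : StrictlyStationary P X)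
    (hcont : ∀ j, Continuous (margF P X j))
    (θ₁ θ₂ θ₃ : ℝ) (hθ₁ : θ₁ ∈ Set.Ioc (0 : ℝ) (1/2)) (hθ₂ : θ₂ ∈ Set.Ioc (0 : ℝ) (1/2))
    (hθ₃ : θ₃ ∈ Set.Ioc (1/2 : ℝ) 1)
    (hC : Condition21 (cop P X)) (h41 : Condition41 P X θ₁) (h43 : Condition43 P X θ₂ θ₃) :
    ∀ c ∈ Set.Ioo (0 : ℝ) 1, ∀ w ∈ Set.Ioo (0 : ℝ) (min (θ₁ / (2 * (1 - θ₁))) (min (θ₂ / (2 * (1 - θ₂))) (θ₃ - 1/2))),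
      ∀ δ : ℕ → ℝ, Antitone δ → Tendsto δ atTop (nhds 0) → (∀ n, c / n ≤ δ n) →
        oP1 P (fun n ω => ⨆ u ∈ NN d (c / n) (δ n), |CPgi P X n u ω / gW w u|) := by
  intro c hc w hw δ _ hδ hcδ
  have hwθ := lt_min_iff.1 hw.2
  have hwθ' := lt_min_iff.1 hwθ.2
  obtain ⟨p, μ, lam, hp, hμ, hlam, hlw, hlp⟩ :=
    exists_exponents hθ₁ hθ₂ hw.1 hwθ.1 hwθ'.1 hwθ'.2
  have hμ1 : μ ≤ 1 := by linarith [hμ.2, hθ₁.2]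
  have hp0 : 0 < p := hw.1.trans hp.1
  have hp1 : p ∈ Ioo (0 : ℝ) 1 := ⟨hp0, by linarith [hp.2, hθ₂.2]⟩
  have hcop := copulaLike_cop hmeas hcont
  obtain ⟨K, hK, hlow, hupp⟩ := abs_Cdot_le_of_condition21 hcop hC
  have hd0 : (0 : ℝ) < d := by exact_mod_cast (by omega : 0 < d)
  have hL : 1 ≤ 2 * K * d + 1 := by linarith [mul_pos (mul_pos two_pos hK) hd0]
  have hδ' : Tendsto (fun n : ℕ => 2 * δ n + 1 / (n : ℝ)) atTop (nhds 0) := by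
    simpa using (hδ.const_mul 2).add tendsto_one_div_atTop_nhds_zero_nat
  intro ε hε
  have he : 0 < ε / (3 * d + 4) := by positivity
  have hη : 0 < ε / (3 * d + 4) * c := mul_pos he hc.1
  rw [ENNReal.tendsto_nhds_zero]
  intro ρ hρ
  obtain ⟨r, hr0, hrρ⟩ : ∃ r : ℝ, 0 < r ∧ ENNReal.ofReal r ≤ ρ := by
    by_cases htop : ρ = ∞
    · exact ⟨1, one_pos, htop ▸ le_top⟩
    · exact ⟨ρ.toReal, ENNReal.toReal_pos hρ.ne' htop, ENNReal.ofReal_toReal_le⟩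
  have hβ := fun k => (h43 p ⟨hp0, hp.2⟩ lam hlam k).2 (r / (2 * d)) (by positivity)
  choose M hM using hβ
  have hmod : ∀ᶠ n in atTop, P {ω | ε / (3 * d + 4) * c * 1 <
      |Mn P X n (2 * δ n + 1 / (n : ℝ)) μ ω|} ≤ ENNReal.ofReal (r / 2) :=
    (ENNReal.tendsto_nhds_zero.1 (h41 μ ⟨hw.1.trans hμ.1, hμ.2⟩ _ hδ' _ hη)) _ (by simpa using hr0)
  have hscale := eventually_scaleBounds (B := ∑ k, |M k|) (L := 2 * K * d + 1)
    hc hw.1 hp.1 hμ.1 hμ1 (by linarith [hμ.1, hμ.2, hθ₁.2]) hη.le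
    (mul_div_cancel_right₀ _ hc.1.ne').le he hL hlam.1 hlw hlp hδ
  filter_upwards [hmod, eventually_all.2 hM, hscale] with n hmod hM hscale
  obtain ⟨hS, hν, hBν⟩ := hscale
  have hn0 : (0 : ℝ) < n := by exact_mod_cast hS.n_pos
  have hδ0 : 0 ≤ δ n := (div_nonneg hc.1.le hn0.le).trans (hcδ n)
  have hsub : {ω | ε * 1 < |(⨆ u ∈ NN d (c / n) (δ n), |CPgi P X n u ω / gW w u|)|} ⊆
      ({ω | ε / (3 * d + 4) * c * 1 < |Mn P X n (2 * δ n + 1 / (n : ℝ)) μ ω|} ∪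
        ⋃ k, {ω | M k < |⨆ s ∈ Ioo ((n : ℝ) ^ (-lam)) (1 - (n : ℝ) ^ (-lam)),
          |betanj P X n k s ω| / (s * (1 - s)) ^ p|}) ∪
        {ω | ¬ ∀ i j, 0 < Uv P X i ω j} := by
    intro ω hω
    by_contra hnot
    simp only [mem_union, mem_iUnion, mem_ofPred_eq, not_or, not_exists, not_lt, not_not,
      mul_one] at hnot
    obtain ⟨⟨hMn, hβn⟩, hpos⟩ := hnot
    have hpath := regularPath_of_bounds hS.n_pos hpos
      (Finset.sum_nonneg fun k _ => abs_nonneg (M k)) hp1 (Real.rpow_pos_of_pos hn0 _) hν hBν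
      (fun k => (hβn k).trans ((le_abs_self _).trans
        (Finset.single_le_sum (f := fun k => |M k|) (fun k _ => abs_nonneg (M k))
          (Finset.mem_univ k)))) hMn
    have h1 := abs_biSup_CPgi_le hd hcop hpath hS (le_add_of_nonneg_right (by positivity))
      (le_add_of_nonneg_left (by positivity)) hK (by linarith) hC.1 hlow hupp
    rw [mul_div_cancel₀ ε (by positivity : (3 * d + 4 : ℝ) ≠ 0)] at h1
    rw [mem_ofPred_eq, mul_one] at hω
    exact absurd h1 (not_le.2 hω)
  have hnull : P {ω | ¬ ∀ i j, 0 < Uv P X i ω j} = 0 := ae_Uv_pos hmeas hstat hcont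
  calc _ ≤ _ := measure_mono hsub
    _ ≤ _ := measure_union_le _ _
    _ ≤ (ENNReal.ofReal (r / 2) + ∑ _k : Fin d, ENNReal.ofReal (r / (2 * d))) + 0 :=
        add_le_add ((measure_union_le _ _).trans (add_le_add hmod
          ((measure_iUnion_fintype_le P _).trans (Finset.sum_le_sum fun k _ => hM k)))) hnull.le
    _ = ENNReal.ofReal r := by
        rw [add_zero, Finset.sum_const, Finset.card_univ, Fintype.card_fin, nsmul_eq_mul,
          ← ENNReal.ofReal_natCast, ← ENNReal.ofReal_mul hd0.le,
          ← ENNReal.ofReal_add (by positivity) (by positivity)]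
        congr 1
        field_simp
        norm_num
    _ ≤ ρ := hrρ

end BBV
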